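/- Let F be a field of characteristic 2, m ≥ 1, and suppose ω ∈ K₂(F)/2^m K₂(F) lifts to a sum of three symbols in K₂(F)/2^{m+1}K₂(F). Then ω is a sum of at most 15 symbols in K₂(F)/2^m K₂(F). -/

import Mathlib

namespace Milnor

variable (F : Type*) [Field F]

/-- Relations defining the Milnor K-group `K_n(F)`: multiplicativity in each
slot and the Steinberg relation. -/
def rels (n : ℕ) : AddSubgroup (FreeAbelianGroup (Fin n → Fˣ)) :=
  AddSubgroup.closure
    ({ x | ∃ (i : Fin n) (u v w : Fin n → Fˣ),
        (∀ j, j ≠ i → u j = v j ∧ u j = w j) ∧ w i = u i * v i ∧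
        x = FreeAbelianGroup.of w - FreeAbelianGroup.of u - FreeAbelianGroup.of v } ∪
     { x | ∃ (i j : Fin n) (u : Fin n → Fˣ), i ≠ j ∧ (u i : F) + (u j : F) = 1 ∧
        x = FreeAbelianGroup.of u })

/-- The Milnor K-group `K_n(F)`. -/
def K (n : ℕ) := FreeAbelianGroup (Fin n → Fˣ) ⧸ rels F n

instance (n : ℕ) : AddCommGroup (K F n) :=
  QuotientAddGroup.Quotient.addCommGroup _

/-- The subgroup `2^m K_n(F)` of `K_n(F)`. -/
def modSub (n m : ℕ) : AddSubgroup (K F n) :=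
  AddSubgroup.closure { x | ∃ y : K F n, x = (2 ^ m) • y }

/-- The quotient `K_n(F)/2^m K_n(F)`. -/
def KMod (n m : ℕ) := K F n ⧸ modSub F n m

instance (n m : ℕ) : AddCommGroup (KMod F n m) :=
  QuotientAddGroup.Quotient.addCommGroup _

variable {F}

/-- The class of the symbol `{v 0, …, v (n-1)}` in `K_n(F)/2^m K_n(F)`. -/
def symbol {n : ℕ} (m : ℕ) (v : Fin n → Fˣ) : KMod F n m :=
  QuotientAddGroup.mk (QuotientAddGroup.mk (FreeAbelianGroup.of v) : K F n)

open scoped Classical in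
/-- `{a,b}` in `K₂(F)/2^m K₂(F)` for field elements, with junk value `0` if an
entry vanishes.  So `s2 1 a b` is `{a,b}₂` and `s2 2 a b` is `{a,b}₄`. -/
noncomputable def s2 (m : ℕ) (a b : F) : KMod F 2 m :=
  if h : a ≠ 0 ∧ b ≠ 0 then symbol m ![Units.mk0 a h.1, Units.mk0 b h.2] else 0

open scoped Classical in
/-- `{a,b,c,d}` in `K₄(F)/2^m K₄(F)` for field elements, junk value `0`. -/
noncomputable def s4 (m : ℕ) (a b c d : F) : KMod F 4 m :=
  if h : a ≠ 0 ∧ b ≠ 0 ∧ c ≠ 0 ∧ d ≠ 0 then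
    symbol m ![Units.mk0 a h.1, Units.mk0 b h.2.1, Units.mk0 c h.2.2.1, Units.mk0 d h.2.2.2]
  else 0

end Milnor

open Milnor


set_option linter.unusedSectionVars false
set_option linter.unusedVariables false

namespace Milnor

section Basics

variable {F : Type*} [Field F]

/-- symbol in `K₂(F)` for units -/
def sy (a b : Fˣ) : K F 2 := (QuotientAddGroup.mk (FreeAbelianGroup.of ![a, b]) : K F 2)

lemma sy_mul_left (a a' b : Fˣ) : sy (a * a') b = sy a b + sy a' b := by
  have h : (FreeAbelianGroup.of ![a * a', b] - FreeAbelianGroup.of ![a, b] -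
      FreeAbelianGroup.of ![a', b]) ∈ rels F 2 := by
    apply AddSubgroup.subset_closure
    left
    refine ⟨0, ![a, b], ![a', b], ![a * a', b], ?_, rfl, rfl⟩
    intro j hj
    fin_cases j
    · exact absurd rfl hj
    · exact ⟨rfl, rfl⟩
  have h2 := (QuotientAddGroup.eq_zero_iff (N := rels F 2) _).2 h
  have h3 : sy (a * a') b - sy a b - sy a' b = 0 := h2
  have h4 := sub_eq_zero.1 (by rw [sub_sub] at h3; exact h3)
  exact h4

lemma sy_mul_right (a b b' : Fˣ) : sy a (b * b') = sy a b + sy a b' := by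
  have h : (FreeAbelianGroup.of ![a, b * b'] - FreeAbelianGroup.of ![a, b] -
      FreeAbelianGroup.of ![a, b']) ∈ rels F 2 := by
    apply AddSubgroup.subset_closure
    left
    refine ⟨1, ![a, b], ![a, b'], ![a, b * b'], ?_, rfl, rfl⟩
    intro j hj
    fin_cases j
    · exact ⟨rfl, rfl⟩
    · exact absurd rfl hj
  have h2 := (QuotientAddGroup.eq_zero_iff (N := rels F 2) _).2 h
  have h3 : sy a (b * b') - sy a b - sy a b' = 0 := h2
  have h4 := sub_eq_zero.1 (by rw [sub_sub] at h3; exact h3)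
  exact h4

lemma sy_steinberg (a b : Fˣ) (h : (a : F) + b = 1) : sy a b = 0 := by
  have h : (FreeAbelianGroup.of ![a, b]) ∈ rels F 2 := by
    apply AddSubgroup.subset_closure
    right
    exact ⟨0, 1, ![a, b], by decide, by simpa using h, rfl⟩
  exact (QuotientAddGroup.eq_zero_iff (N := rels F 2) _).2 h

lemma K2_induction (P : K F 2 → Prop) (h0 : P 0) (hs : ∀ a b, P (sy a b))
    (hneg : ∀ x, P x → P (-x)) (hadd : ∀ x y, P x → P y → P (x + y)) (x : K F 2) : P x := by
  obtain ⟨x, rfl⟩ := QuotientAddGroup.mk_surjective x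
  induction x using FreeAbelianGroup.induction_on with
  | zero => exact h0
  | of v =>
    have : v = ![v 0, v 1] := by ext i; fin_cases i <;> rfl
    rw [this]; exact hs _ _
  | neg v _ =>
    have : v = ![v 0, v 1] := by ext i; fin_cases i <;> rfl
    rw [this]; exact hneg _ (hs _ _)
  | add x y hx hy => exact hadd _ _ hx hy

/-- universal property of `K₂` -/
lemma exists_lift {G : Type*} [AddCommGroup G] (f : Fˣ → Fˣ → G)
    (h1 : ∀ a a' b, f (a * a') b = f a b + f a' b)
    (h2 : ∀ a b b', f a (b * b') = f a b + f a b')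
    (h3 : ∀ a b : Fˣ, (a : F) + b = 1 → f a b = 0) :
    ∃ φ : K F 2 →+ G, ∀ a b, φ (sy a b) = f a b := by
  let g : FreeAbelianGroup (Fin 2 → Fˣ) →+ G := FreeAbelianGroup.lift (fun v => f (v 0) (v 1))
  have hg : rels F 2 ≤ g.ker := by
    rw [rels, AddSubgroup.closure_le]
    have hgo : ∀ v, g (FreeAbelianGroup.of v) = f (v 0) (v 1) := fun v => by
      simp [g]
    rintro x (⟨i, u, v, w, hj, hw, rfl⟩ | ⟨i, j, u, hij, hu, rfl⟩)
    · simp only [SetLike.mem_coe, AddMonoidHom.mem_ker, map_sub, hgo]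
      fin_cases i
      · obtain ⟨h5, h6⟩ := hj 1 (by decide)
        simp only [Fin.zero_eta] at hw
        rw [hw, ← h5, ← h6, h1]; abel
      · obtain ⟨h5, h6⟩ := hj 0 (by decide)
        simp only [Fin.mk_one] at hw
        rw [hw, ← h5, ← h6, h2]; abel
    · simp only [SetLike.mem_coe, AddMonoidHom.mem_ker, hgo]
      have key : (u 0 : F) + u 1 = 1 := by
        fin_cases i <;> fin_cases j
        · exact absurd rfl hij
        · exact hu
        · rw [add_comm]; exact hu
        · exact absurd rfl hij
      exact h3 _ _ key
  refine ⟨QuotientAddGroup.lift (rels F 2) g hg, fun a b => ?_⟩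
  change g (FreeAbelianGroup.of ![a, b]) = _
  simp [g]

open scoped Classical in
/-- symbol for field elements, junk value `0` -/
noncomputable def sf (a b : F) : K F 2 :=
  if h : a ≠ 0 ∧ b ≠ 0 then sy (Units.mk0 a h.1) (Units.mk0 b h.2) else 0

lemma sf_coe (a b : Fˣ) : sf (a : F) b = sy a b := by
  simp [sf]

lemma sf_of_ne {a b : F} (ha : a ≠ 0) (hb : b ≠ 0) :
    sf a b = sy (Units.mk0 a ha) (Units.mk0 b hb) := by
  simp [sf, ha, hb]

@[simp] lemma sf_zero_left (b : F) : sf 0 b = 0 := by simp [sf]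
@[simp] lemma sf_zero_right (b : F) : sf b 0 = 0 := by simp [sf]

lemma sf_mul_left {a a' : F} (b : F) (ha : a ≠ 0) (ha' : a' ≠ 0) :
    sf (a * a') b = sf a b + sf a' b := by
  by_cases hb : b = 0
  · simp [hb]
  rw [sf_of_ne ha hb, sf_of_ne ha' hb, sf_of_ne (mul_ne_zero ha ha') hb, Units.mk0_mul,
    sy_mul_left]

lemma sf_mul_right (a : F) {b b' : F} (hb : b ≠ 0) (hb' : b' ≠ 0) :
    sf a (b * b') = sf a b + sf a b' := by
  by_cases ha : a = 0
  · simp [ha]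
  rw [sf_of_ne ha hb, sf_of_ne ha hb', sf_of_ne ha (mul_ne_zero hb hb'), Units.mk0_mul,
    sy_mul_right]

lemma sf_steinberg {a b : F} (h : a + b = 1) : sf a b = 0 := by
  by_cases ha : a = 0
  · simp [ha]
  by_cases hb : b = 0
  · simp [hb]
  rw [sf_of_ne ha hb]
  exact sy_steinberg _ _ h

@[simp] lemma sf_one_left (b : F) : sf 1 b = 0 := by
  have := sf_mul_left (a := (1 : F)) (a' := 1) b one_ne_zero one_ne_zero
  simpa using this

@[simp] lemma sf_one_right (b : F) : sf b 1 = 0 := by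
  have := sf_mul_right b (b := (1 : F)) (b' := 1) one_ne_zero one_ne_zero
  simpa using this

lemma sf_inv_left (a b : F) : sf a⁻¹ b = - sf a b := by
  by_cases ha : a = 0
  · simp [ha]
  have := sf_mul_left b ha (inv_ne_zero ha)
  rw [mul_inv_cancel₀ ha, sf_one_left] at this
  exact (neg_eq_of_add_eq_zero_right this.symm).symm

lemma sf_inv_right (a b : F) : sf a b⁻¹ = - sf a b := by
  by_cases ha : b = 0
  · simp [ha]
  have := sf_mul_right a ha (inv_ne_zero ha)
  rw [mul_inv_cancel₀ ha, sf_one_right] at this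
  exact (neg_eq_of_add_eq_zero_right this.symm).symm

lemma sf_sq_left (a b : F) : sf (a ^ 2) b = 2 • sf a b := by
  by_cases ha : a = 0
  · simp [ha]
  rw [pow_two, sf_mul_left b ha ha, two_nsmul]

lemma sf_sq_right (a b : F) : sf a (b ^ 2) = 2 • sf a b := by
  by_cases ha : b = 0
  · simp [ha]
  rw [pow_two, sf_mul_right a ha ha, two_nsmul]

variable [CharP F 2]

lemma sf_self (a : F) : sf a a = 0 := by
  by_cases ha : a = 0
  · simp [ha]
  by_cases h1 : a = 1
  · simp [h1]
  have e1 : 1 + a ≠ 0 := fun h => h1 (by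
    have := CharTwo.add_eq_zero.1 h
    exact this.symm)
  have e2 : 1 + a⁻¹ ≠ 0 := by
    intro h; apply e1
    have h' : a * (1 + a⁻¹) = 0 := by rw [h, mul_zero]
    rw [mul_add, mul_inv_cancel₀ ha, mul_one, add_comm] at h'
    exact h'
  have h2 : sf a (1 + a) = 0 := sf_steinberg (by
    rw [add_left_comm, CharTwo.add_self_eq_zero, add_zero])
  have h3 : sf a⁻¹ (1 + a⁻¹) = 0 := sf_steinberg (by
    rw [add_left_comm, CharTwo.add_self_eq_zero, add_zero])
  have h4 : 1 + a = a * (1 + a⁻¹) := by field_simp; ring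
  rw [sf_inv_left, neg_eq_zero] at h3
  rw [h4, sf_mul_right a ha e2, h3, add_zero] at h2
  exact h2

lemma sf_swap (a b : F) : sf a b = - sf b a := by
  by_cases ha : a = 0
  · simp [ha]
  by_cases hb : b = 0
  · simp [hb]
  have := sf_self (a * b)
  rw [sf_mul_left _ ha hb, sf_mul_right _ ha hb, sf_mul_right _ ha hb, sf_self, sf_self, zero_add,
    add_zero] at this
  exact eq_neg_of_add_eq_zero_left this

/-- if `a + b = c`, then `{a,b} = {a,c} + {c,b}`. -/
lemma sf_add {a b c : F} (ha : a ≠ 0) (hb : b ≠ 0) (hc : c ≠ 0) (h : a + b = c) :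
    sf a b = sf a c + sf c b := by
  have h1 : sf (a * c⁻¹) (b * c⁻¹) = 0 := sf_steinberg (by field_simp; exact h)
  rw [sf_mul_left _ ha (inv_ne_zero hc), sf_mul_right _ hb (inv_ne_zero hc),
    sf_mul_right _ hb (inv_ne_zero hc), sf_inv_left, sf_inv_left, sf_inv_right, sf_inv_right,
    sf_self] at h1
  have : sf a b - sf a c - sf c b = 0 := by rw [← h1]; abel
  rw [sub_sub, sub_eq_zero] at this
  exact this

lemma sf_induction (P : K F 2 → Prop) (h0 : P 0) (hs : ∀ a b : F, P (sf a b))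
    (hadd : ∀ x y, P x → P y → P (x + y)) (x : K F 2) : P x := by
  have key : ∀ x : K F 2, P x ∧ P (-x) := by
    intro x
    induction x using K2_induction with
    | h0 => simpa using h0
    | hs a b =>
      rw [← sf_coe, ← sf_inv_left]
      exact ⟨hs _ _, hs _ _⟩
    | hneg x hx => exact ⟨hx.2, by simpa using hx.1⟩
    | hadd x y hx hy =>
      exact ⟨hadd _ _ hx.1 hy.1, by rw [neg_add]; exact hadd _ _ hx.2 hy.2⟩
  exact (key x).1

end Basics

end Milnor

namespace Milnor

section Subfields

variable {F : Type*} [Field F] [CharP F 2]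

/-- adjoin an element to a subfield -/
def adj (K : Subfield F) (l : F) : Subfield F := Subfield.closure (K ∪ {l})

lemma le_adj (K : Subfield F) (l : F) : K ≤ adj K l :=
  fun _ hx => Subfield.subset_closure (Or.inl hx)

lemma self_mem_adj (K : Subfield F) (l : F) : l ∈ adj K l :=
  Subfield.subset_closure (Or.inr rfl)

lemma adj_le {K M : Subfield F} {l : F} (h : K ≤ M) (hl : l ∈ M) : adj K l ≤ M := by
  rw [adj, Subfield.closure_le]
  rintro x (hx | hx)
  · exact h hx
  · rw [Set.mem_singleton_iff.1 hx]; exact hl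

/-- explicit subfield `K + K l` -/
def adjAux (K : Subfield F) (l : F) (hl : l ^ 2 ∈ K) : Subfield F where
  carrier := {f | ∃ p ∈ K, ∃ q ∈ K, f = p + q * l}
  mul_mem' := by
    rintro a b ⟨p, hp, q, hq, rfl⟩ ⟨p', hp', q', hq', rfl⟩
    exact ⟨p * p' + q * q' * l ^ 2, K.add_mem (K.mul_mem hp hp') (K.mul_mem (K.mul_mem hq hq') hl),
      p * q' + q * p', K.add_mem (K.mul_mem hp hq') (K.mul_mem hq hp'), by ring⟩
  one_mem' := ⟨1, K.one_mem, 0, K.zero_mem, by ring⟩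
  add_mem' := by
    rintro a b ⟨p, hp, q, hq, rfl⟩ ⟨p', hp', q', hq', rfl⟩
    exact ⟨p + p', K.add_mem hp hp', q + q', K.add_mem hq hq', by ring⟩
  zero_mem' := ⟨0, K.zero_mem, 0, K.zero_mem, by ring⟩
  neg_mem' := by
    rintro a ⟨p, hp, q, hq, rfl⟩
    exact ⟨-p, K.neg_mem hp, -q, K.neg_mem hq, by ring⟩
  inv_mem' := by
    rintro a ⟨p, hp, q, hq, rfl⟩
    have h2 : (p + q * l) ^ 2 ∈ K := by
      rw [CharTwo.add_sq, mul_pow]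
      exact K.add_mem (K.pow_mem hp 2) (K.mul_mem (K.pow_mem hq 2) hl)
    have h3 : (p + q * l)⁻¹ = (p + q * l) * ((p + q * l) ^ 2)⁻¹ := by
      by_cases h : p + q * l = 0
      · simp [h]
      · field_simp
    refine ⟨p * ((p + q * l) ^ 2)⁻¹, K.mul_mem hp (K.inv_mem h2), q * ((p + q * l) ^ 2)⁻¹,
      K.mul_mem hq (K.inv_mem h2), ?_⟩
    rw [h3]; ring

lemma mem_adj {K : Subfield F} {l : F} (hl : l ^ 2 ∈ K) {f : F} :
    f ∈ adj K l ↔ ∃ p ∈ K, ∃ q ∈ K, f = p + q * l := by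
  constructor
  · intro hf
    have : adj K l ≤ adjAux K l hl := adj_le (fun x hx => ⟨x, hx, 0, K.zero_mem, by ring⟩)
      ⟨0, K.zero_mem, 1, K.one_mem, by ring⟩
    exact this hf
  · rintro ⟨p, hp, q, hq, rfl⟩
    exact (adj K l).add_mem (le_adj K l hp) ((adj K l).mul_mem (le_adj K l hq) (self_mem_adj K l))

/-- the subfield of squares -/
def Fsq (F : Type*) [Field F] [CharP F 2] : Subfield F := (frobenius F 2).fieldRange

lemma sq_mem_Fsq (f : F) : f ^ 2 ∈ Fsq F := ⟨f, rfl⟩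

lemma mem_Fsq {f : F} : f ∈ Fsq F ↔ ∃ g, f = g ^ 2 := by
  constructor
  · rintro ⟨g, rfl⟩; exact ⟨g, rfl⟩
  · rintro ⟨g, rfl⟩; exact sq_mem_Fsq g

lemma zorn_sub {A L : Subfield F} (hAL : A ≤ L) (hsq : ∀ l ∈ L, l ^ 2 ∈ A) {x : F} (hx : x ∈ L)
    (hxA : x ∉ A) : ∃ K : Subfield F, A ≤ K ∧ K ≤ L ∧ x ∉ K ∧
      ∀ l ∈ L, ∃ p ∈ K, ∃ q ∈ K, l = p + q * x := by
  obtain ⟨K, hAK, hK⟩ := zorn_le_nonempty₀ {K : Subfield F | A ≤ K ∧ K ≤ L ∧ x ∉ K} (by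
    intro c hc hch y hy
    refine ⟨sSup c, ⟨(hc hy).1.trans (le_sSup hy), sSup_le fun z hz => (hc hz).2.1, ?_⟩,
      fun z hz => le_sSup hz⟩
    rw [Subfield.mem_sSup_of_directedOn ⟨y, hy⟩ hch.directedOn]
    rintro ⟨z, hz, hxz⟩
    exact (hc hz).2.2 hxz) A ⟨le_rfl, hAL, hxA⟩
  refine ⟨K, hAK, hK.1.2.1, hK.1.2.2, fun l hl => ?_⟩
  by_cases hlK : l ∈ K
  · exact ⟨l, hlK, 0, K.zero_mem, by ring⟩
  have hl2 : l ^ 2 ∈ K := hAK (hsq l hl)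
  have hxl : x ∈ adj K l := by
    by_contra hcon
    have := hK.2 (y := adj K l) ⟨hAK.trans (le_adj K l), adj_le hK.1.2.1 hl, hcon⟩ (le_adj K l)
    exact hlK (this (self_mem_adj K l))
  obtain ⟨p, hp, q, hq, hxe⟩ := (mem_adj hl2).1 hxl
  have hq0 : q ≠ 0 := by
    rintro rfl
    apply hK.1.2.2
    rw [hxe]; simpa using hp
  refine ⟨-p * q⁻¹, K.mul_mem (K.neg_mem hp) (K.inv_mem hq), q⁻¹, K.inv_mem hq, ?_⟩
  rw [hxe]; field_simp; ring

lemma pq_unique {K : Subfield F} {x : F} (hx : x ∉ K) {p q p' q' : F} (hp : p ∈ K) (hq : q ∈ K)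
    (hp' : p' ∈ K) (hq' : q' ∈ K) (h : p + q * x = p' + q' * x) : p = p' ∧ q = q' := by
  have hqq : q = q' := by
    by_contra hne
    apply hx
    have h1 : (q - q') * x = p' - p := by linear_combination h
    have h2 : x = (p' - p) * (q - q')⁻¹ := by
      rw [← h1]; field_simp [sub_ne_zero.2 hne]
    rw [h2]
    exact K.mul_mem (K.sub_mem hp' hp) (K.inv_mem (K.sub_mem hq hq'))
  subst hqq
  exact ⟨by linear_combination h, rfl⟩

lemma exists_der_aux {K : Subfield F} {x : F} (hx : x ∉ K) (hx2 : x ^ 2 ∈ K)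
    (hall : ∀ l : F, ∃ p ∈ K, ∃ q ∈ K, l = p + q * x) :
    ∃ D : Derivation ℤ F F, (∀ a ∈ K, D a = 0) ∧ D x = 1 := by
  choose p hp q hq hpq using hall
  have key : ∀ {f p' q' : F}, p' ∈ K → q' ∈ K → f = p' + q' * x → q f = q' := by
    intro f p' q' hp' hq' hf
    exact (pq_unique hx (hp f) (hq f) hp' hq' ((hpq f).symm.trans hf)).2
  have hadd : ∀ f g, q (f + g) = q f + q g := fun f g =>
    key (K.add_mem (hp f) (hp g)) (K.add_mem (hq f) (hq g)) (by
      linear_combination hpq f + hpq g)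
  have hmul : ∀ f g, q (f * g) = f • q g + g • q f := fun f g => by
    have h1 : q (f * g) = p f * q g + q f * p g := by
      refine key (K.add_mem (K.mul_mem (hp f) (hp g))
        (K.mul_mem (K.mul_mem (hq f) (hq g)) hx2))
        (K.add_mem (K.mul_mem (hp f) (hq g)) (K.mul_mem (hq f) (hp g))) ?_
      conv_lhs => rw [hpq f, hpq g]
      ring
    rw [h1, smul_eq_mul, smul_eq_mul]
    have h2 : (2 : F) = 0 := CharTwo.two_eq_zero
    linear_combination (- q g) * hpq f - q f * hpq g - q f * q g * x * h2
  let d : F →+ F := AddMonoidHom.mk' q hadd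
  refine ⟨Derivation.mk' d.toIntLinearMap hmul, fun a ha => ?_, ?_⟩
  · exact key ha K.zero_mem (by ring)
  · exact key K.zero_mem K.one_mem (by ring)

lemma exists_der {A : Subfield F} (hA : Fsq F ≤ A) {u : F} (hu : u ∉ A) :
    ∃ D : Derivation ℤ F F, (∀ a ∈ A, D a = 0) ∧ D u = 1 := by
  obtain ⟨K, hAK, -, huK, hall⟩ := zorn_sub (L := ⊤) le_top
    (fun l _ => hA (sq_mem_Fsq l)) trivial hu
  obtain ⟨D, hD, hDu⟩ := exists_der_aux huK (hAK (hA (sq_mem_Fsq u))) (fun l => hall l trivial)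
  exact ⟨D, fun a ha => hD a (hAK ha), hDu⟩

lemma der_mul (D : Derivation ℤ F F) (a b : F) : D (a * b) = a * D b + D a * b := by
  rw [D.leibniz, smul_eq_mul, smul_eq_mul]; ring

lemma der_sq (D : Derivation ℤ F F) (a : F) : D (a ^ 2) = 0 := by
  rw [pow_two, der_mul, mul_comm, CharTwo.add_self_eq_zero]

lemma der_inv (D : Derivation ℤ F F) (a : F) : D (a⁻¹) = - D a * (a ^ 2)⁻¹ := by
  by_cases ha : a = 0
  · simp [ha]
  have h1 : D (a * a⁻¹) = 0 := by rw [mul_inv_cancel₀ ha]; exact D.map_one_eq_zero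
  rw [der_mul] at h1
  have : D a⁻¹ = a⁻¹ * (a * D a⁻¹) := by field_simp
  rw [this]
  have h2 : a * D a⁻¹ = - (D a * a⁻¹) := by linear_combination h1
  rw [h2]; field_simp

/-- constants of a derivation -/
def cst (D : Derivation ℤ F F) : Subfield F where
  carrier := {f | D f = 0}
  mul_mem' := by
    intro a b (ha : D a = 0) (hb : D b = 0)
    change D (a * b) = 0
    rw [der_mul, ha, hb]; ring
  one_mem' := D.map_one_eq_zero
  add_mem' := by
    intro a b (ha : D a = 0) (hb : D b = 0)
    change D (a + b) = 0
    rw [map_add, ha, hb, add_zero]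
  zero_mem' := map_zero D
  neg_mem' := by
    intro a (ha : D a = 0)
    change D (-a) = 0
    rw [map_neg, ha, neg_zero]
  inv_mem' := by
    intro a (ha : D a = 0)
    change D (a⁻¹) = 0
    rw [der_inv, ha]; ring

lemma mem_cst {D : Derivation ℤ F F} {f : F} : f ∈ cst D ↔ D f = 0 := Iff.rfl

lemma Fsq_le_cst (D : Derivation ℤ F F) : Fsq F ≤ cst D := by
  intro f hf
  obtain ⟨g, rfl⟩ := mem_Fsq.1 hf
  exact der_sq D g

/-- logarithmic symbol attached to two derivations -/
lemma exists_om (D D' : Derivation ℤ F F) : ∃ φ : K F 2 →+ F, ∀ a b : F,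
    φ (sf a b) = (D a * D' b - D' a * D b) / (a * b) := by
  obtain ⟨φ, hφ⟩ := exists_lift (F := F) (G := F)
    (fun a b => (D (a : F) * D' (b : F) - D' (a : F) * D (b : F)) / ((a : F) * b)) (by
      intro a a' b
      simp only [Units.val_mul, der_mul]
      have := a.ne_zero; have := a'.ne_zero; have := b.ne_zero
      field_simp; ring) (by
      intro a b b'
      simp only [Units.val_mul, der_mul]
      have := a.ne_zero; have := b'.ne_zero; have := b.ne_zero
      field_simp; ring) (by
      intro a b h
      have hb : (b : F) = 1 - a := by linear_combination h
      have e1 : D (b : F) = - D (a : F) := by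
        rw [hb, map_sub, D.map_one_eq_zero, zero_sub]
      have e2 : D' (b : F) = - D' (a : F) := by
        rw [hb, map_sub, D'.map_one_eq_zero, zero_sub]
      simp only [e1, e2]; ring)
  refine ⟨φ, fun a b => ?_⟩
  by_cases ha : a = 0
  · simp [ha]
  by_cases hb : b = 0
  · simp [hb]
  rw [sf_of_ne ha hb, hφ]; simp

/-- the hom `K₂ F → F` attached to two derivations -/
noncomputable def om (D D' : Derivation ℤ F F) : K F 2 →+ F := (exists_om D D').choose

lemma om_sf (D D' : Derivation ℤ F F) (a b : F) :
    om D D' (sf a b) = (D a * D' b - D' a * D b) / (a * b) := (exists_om D D').choose_spec a b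

lemma om_two (D D' : Derivation ℤ F F) (x : K F 2) : om D D' (2 • x) = 0 := by
  rw [map_nsmul, two_nsmul, CharTwo.add_self_eq_zero]

end Subfields

end Milnor

namespace Milnor

section ModTwo

variable {F : Type*} [Field F] [CharP F 2]

/-- the subgroup `2 K₂ F` -/
def M2 (F : Type*) [Field F] : AddSubgroup (K F 2) := (nsmulAddMonoidHom (α := K F 2) 2).range

lemma mem_M2 {x : K F 2} : x ∈ M2 F ↔ ∃ y, x = 2 • y := by
  constructor
  · rintro ⟨y, rfl⟩; exact ⟨y, rfl⟩
  · rintro ⟨y, rfl⟩; exact ⟨y, rfl⟩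

/-- symbols mod 2 -/
noncomputable def ka (a b : F) : K F 2 ⧸ M2 F := QuotientAddGroup.mk' (M2 F) (sf a b)

lemma q_add_self (x : K F 2 ⧸ M2 F) : x + x = 0 := by
  obtain ⟨x, rfl⟩ := QuotientAddGroup.mk'_surjective _ x
  rw [← map_add]
  exact (QuotientAddGroup.eq_zero_iff _).2 (mem_M2.2 ⟨x, by rw [two_nsmul]⟩)

lemma q_neg (x : K F 2 ⧸ M2 F) : -x = x := neg_eq_of_add_eq_zero_right (q_add_self x)

lemma q_eq_of_add {x y : K F 2 ⧸ M2 F} (h : x + y = 0) : x = y := by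
  rw [← q_neg y]; exact eq_neg_of_add_eq_zero_left h

lemma ka_eq_zero {a b : F} : ka a b = 0 ↔ ∃ t, sf a b = 2 • t := by
  rw [← mem_M2]; exact QuotientAddGroup.eq_zero_iff _

lemma ka_mul_left {a a' : F} (b : F) (ha : a ≠ 0) (ha' : a' ≠ 0) :
    ka (a * a') b = ka a b + ka a' b := by
  rw [ka, sf_mul_left b ha ha', map_add]; rfl

lemma ka_mul_right (a : F) {b b' : F} (ha : b ≠ 0) (ha' : b' ≠ 0) :
    ka a (b * b') = ka a b + ka a b' := by
  rw [ka, sf_mul_right a ha ha', map_add]; rfl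

lemma ka_swap (a b : F) : ka a b = ka b a := by
  rw [ka, sf_swap, map_neg]; exact q_neg _

lemma ka_add {a b c : F} (ha : a ≠ 0) (hb : b ≠ 0) (hc : c ≠ 0) (h : a + b = c) :
    ka a b = ka a c + ka c b := by
  rw [ka, sf_add ha hb hc h, map_add]; rfl

lemma ka_sq_left (a b : F) : ka (a ^ 2) b = 0 := ka_eq_zero.2 ⟨_, sf_sq_left a b⟩

lemma ka_sq_right (a b : F) : ka a (b ^ 2) = 0 := ka_eq_zero.2 ⟨_, sf_sq_right a b⟩

lemma ka_inv_right (a b : F) : ka a b⁻¹ = ka a b := by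
  rw [ka, sf_inv_right, map_neg]; exact q_neg _

lemma ka_inv_left (a b : F) : ka a⁻¹ b = ka a b := by
  rw [ka, sf_inv_left, map_neg]; exact q_neg _

/-- `om` mod 2 -/
noncomputable def omb (D D' : Derivation ℤ F F) : (K F 2 ⧸ M2 F) →+ F :=
  QuotientAddGroup.lift (M2 F) (om D D') (by
    intro x hx
    obtain ⟨y, rfl⟩ := mem_M2.1 hx
    exact om_two D D' y)

lemma omb_ka (D D' : Derivation ℤ F F) (a b : F) :
    omb D D' (ka a b) = (D a * D' b - D' a * D b) / (a * b) := om_sf D D' a b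

def SL (n : ℕ) (x : K F 2) : Prop := ∃ u v : Fin n → Fˣ, x = ∑ i, sy (u i) (v i)

lemma SL_zero : SL 0 (0 : K F 2) := ⟨fun _ => 1, fun _ => 1, by simp⟩

lemma SL_sf (a b : F) : SL 1 (sf a b) := by
  by_cases h : a ≠ 0 ∧ b ≠ 0
  · exact ⟨fun _ => Units.mk0 a h.1, fun _ => Units.mk0 b h.2, by simp [sf_of_ne h.1 h.2]⟩
  · refine ⟨fun _ => 1, fun _ => 1, ?_⟩
    have : sy (1 : Fˣ) 1 = 0 := by rw [← sf_coe]; simp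
    simp [sf, h, this]

lemma SL_add {n m : ℕ} {x y : K F 2} (hx : SL n x) (hy : SL m y) : SL (n + m) (x + y) := by
  obtain ⟨u, v, rfl⟩ := hx
  obtain ⟨u', v', rfl⟩ := hy
  refine ⟨Fin.append u u', Fin.append v v', ?_⟩
  simp [Fin.sum_univ_add]

lemma SL_mono {n m : ℕ} (h : n ≤ m) {x : K F 2} (hx : SL n x) : SL m x := by
  induction h with
  | refl => exact hx
  | step _ ih => simpa using SL_add ih (SL_sf (1 : F) 1)

lemma SL_neg {n : ℕ} {x : K F 2} (hx : SL n x) : SL n (-x) := by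
  obtain ⟨u, v, rfl⟩ := hx
  refine ⟨fun i => (u i)⁻¹, v, ?_⟩
  rw [← Finset.sum_neg_distrib]
  refine Finset.sum_congr rfl fun i _ => ?_
  rw [← sf_coe, ← sf_coe, Units.val_inv_eq_inv_val, sf_inv_left]

/-- twice a sum of `n` symbols -/
def Cost (n : ℕ) (x : K F 2) : Prop := ∃ y, SL n y ∧ x = 2 • y

lemma Cost_zero : Cost 0 (0 : K F 2) := ⟨0, SL_zero, by simp⟩

lemma Cost_sf (a b : F) : Cost 1 (2 • sf a b) := ⟨_, SL_sf a b, rfl⟩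

lemma Cost_add {n m : ℕ} {x y : K F 2} (hx : Cost n x) (hy : Cost m y) : Cost (n + m) (x + y) := by
  obtain ⟨u, hu, rfl⟩ := hx
  obtain ⟨v, hv, rfl⟩ := hy
  exact ⟨u + v, SL_add hu hv, by rw [nsmul_add]⟩

lemma Cost_mono {n m : ℕ} (h : n ≤ m) {x : K F 2} (hx : Cost n x) : Cost m x := by
  obtain ⟨u, hu, rfl⟩ := hx
  exact ⟨u, SL_mono h hu, rfl⟩

lemma Cost_neg {n : ℕ} {x : K F 2} (hx : Cost n x) : Cost n (-x) := by
  obtain ⟨u, hu, rfl⟩ := hx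
  exact ⟨-u, SL_neg hu, by rw [smul_neg]⟩

lemma Cost_zero' {n : ℕ} : Cost n (0 : K F 2) := Cost_mono (Nat.zero_le _) Cost_zero

lemma add_ne_of_ne {a b : F} (h : a ≠ b) : a + b ≠ 0 := fun h' => h (CharTwo.add_eq_zero.1 h')

lemma cost_one_add (α t : F) (hα : α ≠ 0) : Cost 1 (sf α (1 + t ^ 2 * α)) := by
  by_cases ht : t = 0
  · rw [ht]; simpa using Cost_zero'
  have h : sf (t ^ 2 * α) (1 + t ^ 2 * α) = 0 := sf_steinberg (by
    rw [add_left_comm, CharTwo.add_self_eq_zero, add_zero])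
  rw [sf_mul_left _ (pow_ne_zero 2 ht) hα, sf_sq_left] at h
  rw [eq_neg_of_add_eq_zero_right h]
  exact Cost_neg (Cost_sf _ _)

lemma triv_cost {α β : F} (h : α ∈ Fsq F ∨ β ∈ adj (Fsq F) α) : Cost 2 (sf α β) := by
  by_cases hα : α = 0
  · rw [hα, sf_zero_left]; exact Cost_zero'
  by_cases hβ : β = 0
  · rw [hβ, sf_zero_right]; exact Cost_zero'
  rcases h with h | h
  · obtain ⟨g, rfl⟩ := mem_Fsq.1 h
    rw [sf_sq_left]; exact Cost_mono one_le_two (Cost_sf _ _)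
  obtain ⟨p, hp, q, hq, rfl⟩ := (mem_adj (sq_mem_Fsq α)).1 h
  obtain ⟨g, rfl⟩ := mem_Fsq.1 hp
  obtain ⟨k, rfl⟩ := mem_Fsq.1 hq
  by_cases hg : g = 0
  · subst hg
    have hk : k ≠ 0 := by rintro rfl; simp at hβ
    have e : (0 : F) ^ 2 + k ^ 2 * α = k ^ 2 * α := by ring
    rw [e, sf_mul_right _ (pow_ne_zero 2 hk) hα, sf_self, sf_sq_right, add_zero]
    exact Cost_mono one_le_two (Cost_sf _ _)
  have e : g ^ 2 + k ^ 2 * α = g ^ 2 * (1 + (k / g) ^ 2 * α) := by field_simp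
  have hne : 1 + (k / g) ^ 2 * α ≠ 0 := by
    intro h0; apply hβ; rw [e, h0, mul_zero]
  rw [e, sf_mul_right _ (pow_ne_zero 2 hg) hne, sf_sq_right]
  exact Cost_add (Cost_sf _ _) (cost_one_add _ _ hα)

/-- dual toric derivations -/
structure Dual (α β : F) (D1 D2 : Derivation ℤ F F) : Prop where
  ha : α ≠ 0
  hb : β ≠ 0
  h1a : D1 α = α
  h1b : D1 β = 0
  h2a : D2 α = 0
  h2b : D2 β = β

/-- nontrivial pair -/
def NT (α β : F) : Prop := α ∉ Fsq F ∧ β ∉ adj (Fsq F) α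

lemma exists_dual {α β : F} (h : NT α β) : ∃ D1 D2, Dual α β D1 D2 := by
  obtain ⟨D2, hD2, h2⟩ := exists_der (le_adj _ _) h.2
  obtain ⟨D1, hD1, h1⟩ := exists_der le_rfl h.1
  refine ⟨α • D1 - (α * D1 β) • D2, β • D2, ?_, ?_, ?_, ?_, ?_, ?_⟩
  · rintro rfl; exact h.1 (Fsq F).zero_mem
  · rintro rfl; exact h.2 (adj (Fsq F) α).zero_mem
  · simp [h1, hD2 α (self_mem_adj _ _)]
  · simp [h2]
  · simp [hD2 α (self_mem_adj _ _)]
  · simp [h2]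

lemma Dual.omb_one {α β : F} {D1 D2 : Derivation ℤ F F} (h : Dual α β D1 D2) :
    omb D1 D2 (ka α β) = 1 := by
  rw [omb_ka, h.h1a, h.h1b, h.h2a, h.h2b]
  have := h.ha; have := h.hb
  field_simp; ring

lemma NT.ne {α β : F} (h : NT α β) : ka α β ≠ 0 := by
  obtain ⟨D1, D2, hd⟩ := exists_dual h
  intro h0
  have := hd.omb_one
  rw [h0, map_zero] at this
  exact zero_ne_one this

lemma NT_iff {α β : F} : NT α β ↔ ka α β ≠ 0 := by
  refine ⟨NT.ne, fun h => ?_⟩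
  by_contra hc
  apply h
  rw [NT, not_and_or, not_not, not_not] at hc
  obtain ⟨y, -, hy⟩ := triv_cost hc
  exact ka_eq_zero.2 ⟨y, hy⟩

lemma triv_cost' {α β : F} (h : ka α β = 0) : Cost 2 (sf α β) := by
  apply triv_cost
  by_contra hc
  push Not at hc
  exact NT.ne hc h

lemma NT.ha {α β : F} (h : NT α β) : α ≠ 0 := by
  rintro rfl; exact h.1 (Fsq F).zero_mem

lemma NT.hb {α β : F} (h : NT α β) : β ≠ 0 := by
  rintro rfl; exact h.2 (adj (Fsq F) α).zero_mem

/-- the field `F²(α,β)` -/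
def LL (α β : F) : Subfield F := adj (adj (Fsq F) α) β

lemma Fsq_le_LL (α β : F) : Fsq F ≤ LL α β := (le_adj _ _).trans (le_adj _ _)
lemma left_mem_LL (α β : F) : α ∈ LL α β := le_adj _ _ (self_mem_adj _ _)
lemma right_mem_LL (α β : F) : β ∈ LL α β := self_mem_adj _ _
lemma sq_mem_LL (α β z : F) : z ^ 2 ∈ LL α β := Fsq_le_LL α β (sq_mem_Fsq z)

lemma LL_le {α β : F} {M : Subfield F} (h : Fsq F ≤ M) (ha : α ∈ M) (hb : β ∈ M) : LL α β ≤ M :=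
  adj_le (adj_le h ha) hb

lemma Dual.coords {α β : F} {D1 D2 : Derivation ℤ F F} (h : Dual α β D1 D2) {z : F}
    (hz : z ∈ LL α β) : ∃ c0 c1 c2 c3 : F,
      z = c0 ^ 2 + c1 ^ 2 * α + c2 ^ 2 * β + c3 ^ 2 * (α * β) ∧
      D1 z = c1 ^ 2 * α + c3 ^ 2 * (α * β) ∧ D2 z = c2 ^ 2 * β + c3 ^ 2 * (α * β) ∧
      D1 (D2 z) = c3 ^ 2 * (α * β) ∧ D2 (D1 z) = c3 ^ 2 * (α * β) ∧
      D1 (D1 z) = D1 z ∧ D2 (D2 z) = D2 z := by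
  obtain ⟨p, hp, q, hq, rfl⟩ := (mem_adj (le_adj _ _ (sq_mem_Fsq β))).1 hz
  obtain ⟨p0, hp0, p1, hp1, rfl⟩ := (mem_adj (sq_mem_Fsq α)).1 hp
  obtain ⟨q0, hq0, q1, hq1, rfl⟩ := (mem_adj (sq_mem_Fsq α)).1 hq
  obtain ⟨p0, rfl⟩ := mem_Fsq.1 hp0
  obtain ⟨p1, rfl⟩ := mem_Fsq.1 hp1
  obtain ⟨q0, rfl⟩ := mem_Fsq.1 hq0
  obtain ⟨q1, rfl⟩ := mem_Fsq.1 hq1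
  have e1 : D1 (p0 ^ 2 + p1 ^ 2 * α + (q0 ^ 2 + q1 ^ 2 * α) * β) =
      p1 ^ 2 * α + q1 ^ 2 * (α * β) := by
    simp only [map_add, der_mul, der_sq, h.h1a, h.h1b]; ring
  have e2 : D2 (p0 ^ 2 + p1 ^ 2 * α + (q0 ^ 2 + q1 ^ 2 * α) * β) =
      q0 ^ 2 * β + q1 ^ 2 * (α * β) := by
    simp only [map_add, der_mul, der_sq, h.h2a, h.h2b]; ring
  refine ⟨p0, p1, q0, q1, by ring, e1, e2, ?_, ?_, ?_, ?_⟩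
  · rw [e2]; simp only [map_add, der_mul, der_sq, h.h1a, h.h1b]; ring
  · rw [e1]; simp only [map_add, der_mul, der_sq, h.h2a, h.h2b]; ring
  · rw [e1]; simp only [map_add, der_mul, der_sq, h.h1a, h.h1b]; ring
  · rw [e2]; simp only [map_add, der_mul, der_sq, h.h2a, h.h2b]; ring

/-- constant-coefficient projection -/
def pr (D1 D2 : Derivation ℤ F F) (z : F) : F := z + D1 z + D2 z + D1 (D2 z)

lemma Dual.pr_sq {α β : F} {D1 D2 : Derivation ℤ F F} (h : Dual α β D1 D2) {z : F}
    (hz : z ∈ LL α β) : ∃ c0 c1 c2 c3 : F,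
      z = c0 ^ 2 + c1 ^ 2 * α + c2 ^ 2 * β + c3 ^ 2 * (α * β) ∧ pr D1 D2 z = c0 ^ 2 := by
  obtain ⟨c0, c1, c2, c3, e, e1, e2, e3, -⟩ := h.coords hz
  refine ⟨c0, c1, c2, c3, e, ?_⟩
  rw [pr, e3, e1, e2]
  conv_lhs => rw [e]
  have h2 : (2 : F) = 0 := CharTwo.two_eq_zero
  linear_combination (c1 ^ 2 * α + c2 ^ 2 * β + 2 * c3 ^ 2 * (α * β)) * h2

lemma pr_add (D1 D2 : Derivation ℤ F F) (x y : F) : pr D1 D2 (x + y) = pr D1 D2 x + pr D1 D2 y := by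
  simp only [pr, map_add]; ring

lemma pr_sub (D1 D2 : Derivation ℤ F F) (x y : F) : pr D1 D2 (x - y) = pr D1 D2 x - pr D1 D2 y := by
  simp only [pr, map_sub]; ring

lemma pr_sq_mul (D1 D2 : Derivation ℤ F F) (x y : F) :
    pr D1 D2 (x ^ 2 * y) = x ^ 2 * pr D1 D2 y := by
  simp only [pr, der_mul, der_sq, zero_mul, add_zero]; ring

lemma Dual.pr_D1 {α β : F} {D1 D2 : Derivation ℤ F F} (h : Dual α β D1 D2) {z : F}
    (hz : z ∈ LL α β) : pr D1 D2 (D1 z) = 0 := by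
  obtain ⟨c0, c1, c2, c3, e, e1, e2, e3, e4, e5, e6⟩ := h.coords hz
  have e7 : D1 (c3 ^ 2 * (α * β)) = c3 ^ 2 * (α * β) := by
    simp only [der_mul, der_sq, h.h1a, h.h1b]; ring
  rw [pr, e5, e4, e7, CharTwo.add_self_eq_zero, zero_add, CharTwo.add_self_eq_zero]

lemma Dual.pr_D2 {α β : F} {D1 D2 : Derivation ℤ F F} (h : Dual α β D1 D2) {z : F}
    (hz : z ∈ LL α β) : pr D1 D2 (D2 z) = 0 := by
  obtain ⟨c0, c1, c2, c3, e, e1, e2, e3, e4, e5, e6⟩ := h.coords hz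
  rw [pr, e6]
  have h2 : (2 : F) = 0 := CharTwo.two_eq_zero
  linear_combination (D2 z + D1 (D2 z)) * h2

lemma Dual.D_mem {α β : F} {D1 D2 : Derivation ℤ F F} (h : Dual α β D1 D2) {z : F}
    (hz : z ∈ LL α β) : D1 z ∈ LL α β ∧ D2 z ∈ LL α β := by
  obtain ⟨c0, c1, c2, c3, e, e1, e2, -⟩ := h.coords hz
  have m1 := left_mem_LL α β
  have m2 := right_mem_LL α β
  have m := sq_mem_LL α β
  rw [e1, e2]
  exact ⟨add_mem (mul_mem (m _) m1) (mul_mem (m _) (mul_mem m1 m2)),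
    add_mem (mul_mem (m _) m2) (mul_mem (m _) (mul_mem m1 m2))⟩

lemma Dual.left_mem {α β : F} {D1 D2 : Derivation ℤ F F} (h : Dual α β D1 D2) {u v : F}
    (hu : u ≠ 0) (hv : v ≠ 0) (huv : ka u v = ka α β) : u ∈ LL α β := by
  by_contra hc
  obtain ⟨D, hD, hDu⟩ := exists_der (Fsq_le_LL α β) hc
  have key : ∀ D' : Derivation ℤ F F, D' v = D' u * D v := by
    intro D'
    have h1 := congrArg (omb D D') huv
    rw [omb_ka, omb_ka, hD α (left_mem_LL _ _), hD β (right_mem_LL _ _), hDu] at h1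
    have h2 : (1 * D' v - D' u * D v) = 0 := by
      have : (1 * D' v - D' u * D v) / (u * v) = 0 := by rw [h1]; simp
      rcases div_eq_zero_iff.1 this with h3 | h3
      · exact h3
      · exact absurd h3 (mul_ne_zero hu hv)
    linear_combination h2
  have h3 := h.omb_one
  rw [← huv, omb_ka, key D1, key D2] at h3
  have : D1 u * (D2 u * D v) - D2 u * (D1 u * D v) = 0 := by ring
  rw [this, zero_div] at h3
  exact zero_ne_one h3

lemma Dual.jac {α β : F} {D1 D2 : Derivation ℤ F F} (h : Dual α β D1 D2) {u v : F}
    (hu : u ≠ 0) (hv : v ≠ 0) (huv : ka u v = ka α β) : D1 u * D2 v - D2 u * D1 v = u * v := by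
  have h3 := h.omb_one
  rw [← huv, omb_ka] at h3
  field_simp at h3
  exact h3

lemma Dual.pr_left {α β : F} {D1 D2 : Derivation ℤ F F} (h : Dual α β D1 D2) {u v : F}
    (hu : u ≠ 0) (hv : v ≠ 0) (huv : ka u v = ka α β) : pr D1 D2 u = 0 := by
  have mu := h.left_mem hu hv huv
  have mv := h.left_mem hv hu ((ka_swap v u).trans huv)
  have J := h.jac hu hv huv
  obtain ⟨c0, c1, c2, c3, -, e1, e2, e3, e4, e5, e6⟩ := h.coords mv
  have key : u = D1 (u * D2 v * v⁻¹) - D2 (u * D1 v * v⁻¹) := by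
    simp only [der_mul, der_inv, e3, e4]
    field_simp
    linear_combination -v * J
  rw [key, pr_sub, h.pr_D1, h.pr_D2, sub_zero]
  · exact mul_mem (mul_mem mu (h.D_mem mv).1) (inv_mem mv)
  · exact mul_mem (mul_mem mu (h.D_mem mv).2) (inv_mem mv)

lemma Dual.pr_mul {α β : F} {D1 D2 : Derivation ℤ F F} (h : Dual α β D1 D2) {u v : F}
    (hu : u ≠ 0) (hv : v ≠ 0) (huv : ka u v = ka α β) : pr D1 D2 (u * v) = 0 := by
  have mu := h.left_mem hu hv huv
  have mv := h.left_mem hv hu ((ka_swap v u).trans huv)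
  have J := h.jac hu hv huv
  obtain ⟨c0, c1, c2, c3, -, e1, e2, e3, e4, e5, e6⟩ := h.coords mv
  have key : u * v = D1 (u * D2 v) - D2 (u * D1 v) := by
    simp only [der_mul, e3, e4]
    linear_combination -J
  rw [key, pr_sub, h.pr_D1, h.pr_D2, sub_zero]
  · exact mul_mem mu (h.D_mem mv).1
  · exact mul_mem mu (h.D_mem mv).2

lemma Dual.pr_zero {α β : F} {D1 D2 : Derivation ℤ F F} (h : Dual α β D1 D2) {z : F}
    (hz : z ∈ LL α β) (h0 : pr D1 D2 z = 0) : ∃ c1 c2 c3 : F,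
      z = c1 ^ 2 * α + c2 ^ 2 * β + c3 ^ 2 * (α * β) := by
  obtain ⟨c0, c1, c2, c3, e, e0⟩ := h.pr_sq hz
  rw [h0] at e0
  exact ⟨c1, c2, c3, by rw [e, ← e0]; ring⟩

/-- the pair lemma -/
lemma pair_lemma {α β u v : F} (hα : α ≠ 0) (hβ : β ≠ 0) (hu : u ≠ 0) (hv : v ≠ 0)
    (h : ka α β = ka u v) : Cost 5 (sf α β - sf u v) := by
  by_cases hnt : ka α β = 0
  · have h1 := triv_cost' hnt
    have h2 := triv_cost' (h ▸ hnt)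
    rw [sub_eq_add_neg]
    exact Cost_mono (by norm_num) (Cost_add h1 (Cost_neg h2))
  have NT1 := NT_iff.2 hnt
  have NT2 : NT u v := NT_iff.2 (h ▸ hnt)
  obtain ⟨D1, D2, hd⟩ := exists_dual NT1
  have mu := hd.left_mem hu hv h.symm
  have mv := hd.left_mem hv hu ((ka_swap v u).trans h.symm)
  obtain ⟨a1, b1, d1, ev⟩ := hd.pr_zero mv (hd.pr_left hv hu ((ka_swap v u).trans h.symm))
  obtain ⟨a2, b2, d2, euv⟩ := hd.pr_zero (mul_mem mu mv) (hd.pr_mul hu hv h.symm)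
  have h2 : (2 : F) = 0 := CharTwo.two_eq_zero
  -- find the common element
  obtain ⟨g, k, hgk, hgk0⟩ : ∃ g k : F, g * a1 + k * a2 = 0 ∧ (g ≠ 0 ∨ k ≠ 0) := by
    by_cases h0 : a1 = 0 ∧ a2 = 0
    · exact ⟨1, 0, by rw [h0.1]; ring, Or.inl one_ne_zero⟩
    · refine ⟨a2, a1, by linear_combination a1 * a2 * h2, ?_⟩
      by_contra hcon
      push Not at hcon
      exact h0 ⟨hcon.2, hcon.1⟩
  have hN' : g ^ 2 + k ^ 2 * u ≠ 0 := by
    intro h0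
    by_cases hk : k = 0
    · subst hk
      rcases hgk0 with h' | h'
      · apply h'; simpa using h0
      · exact h' rfl
    · apply NT2.1
      have : u = (g * k⁻¹) ^ 2 := by
        field_simp
        linear_combination h0 - g ^ 2 * h2
      rw [this]; exact sq_mem_Fsq _
  obtain ⟨r, s, ey⟩ : ∃ r s : F, v * (g ^ 2 + k ^ 2 * u) = β * (r ^ 2 + s ^ 2 * α) := by
    refine ⟨g * b1 + k * b2, g * d1 + k * d2, ?_⟩
    have e0 : (g * a1 + k * a2) ^ 2 = 0 := by rw [hgk]; ring
    linear_combination g ^ 2 * ev + k ^ 2 * euv + e0 * α -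
      (g * k * a1 * a2 * α + g * b1 * k * b2 * β + g * d1 * k * d2 * α * β) * h2
  have hy0 : v * (g ^ 2 + k ^ 2 * u) ≠ 0 := mul_ne_zero hv hN'
  obtain ⟨y, g', k', hy, ey1, hc1⟩ : ∃ y g' k' : F, y ≠ 0 ∧ y = v * (g' ^ 2 + k' ^ 2 * u) ∧
      Cost 1 (sf α β - sf α y) := by
    by_cases hr : r = 0
    · subst hr
      have hs : s ≠ 0 := by
        rintro rfl
        apply hy0; rw [ey]; ring
      refine ⟨β * α, g * s⁻¹, k * s⁻¹, mul_ne_zero hβ hα, ?_, ?_⟩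
      · field_simp
        linear_combination -ey
      · rw [sf_mul_right _ hβ hα, sf_self, add_zero, sub_self]; exact Cost_zero'
    · have e2 : β * (1 + (s / r) ^ 2 * α) = v * ((g * r⁻¹) ^ 2 + (k * r⁻¹) ^ 2 * u) := by
        field_simp
        linear_combination -ey
      have hne : β * (1 + (s / r) ^ 2 * α) ≠ 0 := by
        rw [e2]
        have : v * ((g * r⁻¹) ^ 2 + (k * r⁻¹) ^ 2 * u) = v * (g ^ 2 + k ^ 2 * u) * (r⁻¹) ^ 2 := by
          ring
        rw [this]
        exact mul_ne_zero hy0 (pow_ne_zero 2 (inv_ne_zero hr))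
      refine ⟨_, g * r⁻¹, k * r⁻¹, hne, e2, ?_⟩
      rw [sf_mul_right _ hβ (right_ne_zero_of_mul hne)]
      have := Cost_neg (cost_one_add α (s / r) hα)
      convert this using 1; abel
  have hN2 : g' ^ 2 + k' ^ 2 * u ≠ 0 := by
    intro h0; apply hy; rw [ey1, h0, mul_zero]
  have hc3 : Cost 2 (sf u (g' ^ 2 + k' ^ 2 * u)) := triv_cost (Or.inr
    ((mem_adj (sq_mem_Fsq u)).2 ⟨_, sq_mem_Fsq g', _, sq_mem_Fsq k', rfl⟩))
  have e3 : sf u y = sf u v + sf u (g' ^ 2 + k' ^ 2 * u) := by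
    rw [ey1, sf_mul_right _ hv hN2]
  have e4 : sf (u * α⁻¹) y = sf u y - sf α y := by
    rw [sf_mul_left _ hu (inv_ne_zero hα), sf_inv_left]; abel
  have hc2 : Cost 2 (sf (u * α⁻¹) y) := by
    apply triv_cost'
    obtain ⟨t1, -, ht1⟩ := hc1
    obtain ⟨t3, -, ht3⟩ := hc3
    have q1 : ka α β = ka α y := by
      rw [ka, ka, ← sub_eq_zero, ← map_sub]
      exact (QuotientAddGroup.eq_zero_iff _).2 (mem_M2.2 ⟨t1, ht1⟩)
    have q3 : ka u y = ka u v := by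
      rw [ka, e3, map_add, ht3]
      have : QuotientAddGroup.mk' (M2 F) (2 • t3) = 0 :=
        (QuotientAddGroup.eq_zero_iff _).2 (mem_M2.2 ⟨t3, rfl⟩)
      rw [this, add_zero]; rfl
    rw [ka_mul_left _ hu (inv_ne_zero hα), ka_inv_left, q3, ← q1, h, q_add_self]
  have := Cost_add (Cost_add hc1 (Cost_neg hc2)) hc3
  convert this using 1
  rw [e4, e3]; abel

/-- slot lemma -/
lemma slot_lemma {α β u c1 c2 c3 : F} (hα : α ≠ 0) (hβ : β ≠ 0) (hu : u ≠ 0)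
    (e : u = c1 ^ 2 * α + c2 ^ 2 * β + c3 ^ 2 * (α * β)) : ∃ y, y ≠ 0 ∧ ka α β = ka u y := by
  by_cases hN : c2 ^ 2 + c3 ^ 2 * α = 0
  · have e1 : u = c1 ^ 2 * α := by linear_combination e + β * hN
    have hc1 : c1 ≠ 0 := by rintro rfl; apply hu; rw [e1]; ring
    refine ⟨β, hβ, ?_⟩
    rw [e1, ka_mul_left _ (pow_ne_zero 2 hc1) hα, ka_sq_left, zero_add]
  have hkN : ka α (c2 ^ 2 + c3 ^ 2 * α) = 0 := by
    obtain ⟨y, -, hy⟩ := triv_cost (α := α) (Or.inr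
      ((mem_adj (sq_mem_Fsq α)).2 ⟨_, sq_mem_Fsq c2, _, sq_mem_Fsq c3, rfl⟩))
    exact ka_eq_zero.2 ⟨y, hy⟩
  have hk : ka α (β * (c2 ^ 2 + c3 ^ 2 * α)) = ka α β := by
    rw [ka_mul_right _ hβ hN, hkN, add_zero]
  by_cases hc1 : c1 = 0
  · refine ⟨α, hα, ?_⟩
    have e1 : u = β * (c2 ^ 2 + c3 ^ 2 * α) := by rw [e, hc1]; ring
    rw [e1, ka_swap _ α, hk]
  · have hA : c1 ^ 2 * α ≠ 0 := mul_ne_zero (pow_ne_zero 2 hc1) hα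
    have hB := mul_ne_zero hβ hN
    refine ⟨(c1 ^ 2 * α)⁻¹ * (β * (c2 ^ 2 + c3 ^ 2 * α)), mul_ne_zero (inv_ne_zero hA) hB, ?_⟩
    have e2 := ka_add hA hB hu (by rw [e]; ring)
    rw [ka_mul_right _ (inv_ne_zero hA) hB, ka_inv_right, ka_swap u, ← e2,
      ka_mul_left _ (pow_ne_zero 2 hc1) hα, ka_sq_left, zero_add, hk]

lemma slot_ne {γ δ c1 c2 c3 : F} (h : NT γ δ) (hc : c2 ≠ 0 ∨ c3 ≠ 0) :
    c1 ^ 2 * γ + c2 ^ 2 * δ + c3 ^ 2 * (γ * δ) ≠ 0 := by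
  intro h0
  have h2 : (2 : F) = 0 := CharTwo.two_eq_zero
  by_cases hN : c2 ^ 2 + c3 ^ 2 * γ = 0
  · by_cases h3 : c3 = 0
    · subst h3
      rcases hc with h' | h'
      · apply h'; simpa using hN
      · exact h' rfl
    · apply h.1
      have : γ = (c2 * c3⁻¹) ^ 2 := by
        field_simp
        linear_combination hN - c2 ^ 2 * h2
      rw [this]; exact sq_mem_Fsq _
  · apply h.2
    have : δ = (c1 ^ 2 * γ) * (c2 ^ 2 + c3 ^ 2 * γ)⁻¹ := by
      rw [eq_mul_inv_iff_mul_eq₀ hN]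
      linear_combination h0 - c1 ^ 2 * γ * h2
    rw [this]
    have m1 := self_mem_adj (Fsq F) γ
    have m : ∀ z : F, z ^ 2 ∈ adj (Fsq F) γ := fun z => le_adj _ _ (sq_mem_Fsq z)
    exact mul_mem (mul_mem (m _) m1) (inv_mem (add_mem (m _) (mul_mem (m _) m1)))

end ModTwo

end Milnor

namespace Milnor

section CommonSlot

variable {F : Type*} [Field F] [CharP F 2]

/-- the square of a derivation in characteristic two -/
noncomputable def sqD (D : Derivation ℤ F F) : Derivation ℤ F F :=
  Derivation.mk' ((D : F →ₗ[ℤ] F).comp (D : F →ₗ[ℤ] F)) (by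
    intro a b
    have h2 : (2 : F) = 0 := CharTwo.two_eq_zero
    change D (D (a * b)) = a • D (D b) + b • D (D a)
    simp only [der_mul, map_add, smul_eq_mul]
    linear_combination D a * D b * h2)

lemma sqD_apply (D : Derivation ℤ F F) (a : F) : sqD D a = D (D a) := rfl

/-- everything generated by four elements lying in the kernel of a derivation -/
lemma der_eq_of_mem {D D' : Derivation ℤ F F} {α β γ z : F} (h1 : D α = D' α) (h2 : D β = D' β)
    (h3 : D γ = D' γ) (hz : z ∈ adj (LL α β) γ) : D z = D' z := by
  have key : adj (LL α β) γ ≤ cst (D - D') :=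
    adj_le (LL_le (Fsq_le_cst _) (by rw [mem_cst]; simp [h1]) (by rw [mem_cst]; simp [h2]))
      (by rw [mem_cst]; simp [h3])
  have := mem_cst.1 (key hz)
  simpa [sub_eq_zero] using this

lemma div_zero_num {x y : F} (hy : y ≠ 0) (h : x / y = 0) : x = 0 := by
  rcases div_eq_zero_iff.1 h with h | h
  · exact h
  · exact absurd h hy

set_option maxHeartbeats 800000 in
lemma lemmaR {α β γ δ a b : F} {D1 D2 Γ : Derivation ℤ F F} (hd : Dual α β D1 D2)
    (hΓ : ∀ z ∈ LL α β, Γ z = 0) (hΓγ : Γ γ = γ) (h1γ : D1 γ = 0) (h2γ : D2 γ = 0)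
    (hγ : γ ≠ 0) (hδ : δ ≠ 0) (ha : a ≠ 0) (hb : b ≠ 0) (h : ka a b = ka α β + ka γ δ) :
    δ ∈ adj (LL α β) γ ∧
    D1 δ * (δ + D1 δ + D2 δ + D1 (D2 δ) + Γ δ) = δ * Γ (D1 δ) ∧
    D2 δ * (δ + D1 δ + D2 δ + D1 (D2 δ) + Γ δ) = δ * Γ (D2 δ) := by
  have hα := hd.ha
  have hβ := hd.hb
  have hc2 : (2 : F) = 0 := CharTwo.two_eq_zero
  have hΓα := hΓ α (left_mem_LL _ _)
  have hΓβ := hΓ β (right_mem_LL _ _)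
  have hom : ∀ D D' : Derivation ℤ F F, (D a * D' b - D' a * D b) / (a * b) =
      (D α * D' β - D' α * D β) / (α * β) + (D γ * D' δ - D' γ * D δ) / (γ * δ) := by
    intro D D'
    have := congrArg (omb D D') h
    simpa only [map_add, omb_ka] using this
  have hab : a * b ≠ 0 := mul_ne_zero ha hb
  have J : D1 a * D2 b - D2 a * D1 b = a * b := by
    have := hom D1 D2
    rw [hd.h1a, hd.h1b, hd.h2a, hd.h2b, h1γ, h2γ] at this
    have e : (α * β - 0 * 0) / (α * β) = 1 := by field_simp; ring
    rw [e] at this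
    rw [div_eq_iff hab] at this
    rw [this]; ring
  have hS : ∀ X : Derivation ℤ F F, X a * D1 b - D1 a * X b = 0 → X a * D2 b - D2 a * X b = 0 →
      X a = 0 ∧ X b = 0 := by
    intro X h1 h2
    constructor
    · have : X a * (a * b) = 0 := by rw [← J]; linear_combination D1 a * h2 - D2 a * h1
      rcases mul_eq_zero.1 this with h' | h'
      · exact h'
      · exact absurd h' hab
    · have : X b * (a * b) = 0 := by rw [← J]; linear_combination D1 b * h2 - D2 b * h1
      rcases mul_eq_zero.1 this with h' | h'
      · exact h'
      · exact absurd h' hab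
  have hM : Fsq F ≤ adj (LL α β) γ := (Fsq_le_LL _ _).trans (le_adj _ _)
  have mα : α ∈ adj (LL α β) γ := le_adj _ _ (left_mem_LL _ _)
  have mβ : β ∈ adj (LL α β) γ := le_adj _ _ (right_mem_LL _ _)
  have mγ : γ ∈ adj (LL α β) γ := self_mem_adj _ _
  have hδM : δ ∈ adj (LL α β) γ := by
    by_contra hc
    obtain ⟨D4, hD4, h4⟩ := exists_der hM hc
    have e1 := hom D4 D1
    have e2 := hom D4 D2
    have e3 := hom D4 Γ
    rw [hD4 _ mα, hD4 _ mβ, hD4 _ mγ, h1γ] at e1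
    rw [hD4 _ mα, hD4 _ mβ, hD4 _ mγ, h2γ] at e2
    obtain ⟨f1, f2⟩ := hS D4 (div_zero_num hab (by rw [e1]; simp)) (div_zero_num hab (by rw [e2]; simp))
    rw [f1, f2, hD4 _ mα, hD4 _ mβ, hD4 _ mγ, hΓγ, h4] at e3
    have e4 : γ / (γ * δ) = 0 := by
      have e5 : -(γ / (γ * δ)) = (0 * Γ b - Γ a * 0) / (a * b) := by rw [e3]; ring
      rw [zero_mul, mul_zero, sub_zero, zero_div, neg_eq_zero] at e5
      exact e5
    exact hγ (div_zero_num (mul_ne_zero hγ hδ) e4)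
  have comm : D1 (D2 δ) = D2 (D1 δ) := by
    have := der_eq_of_mem (D := ⁅D1, D2⁆) (D' := 0) (z := δ) (α := α) (β := β) (γ := γ)
      (by simp [Derivation.commutator_apply, hd.h1a, hd.h2a])
      (by simp [Derivation.commutator_apply, hd.h1b, hd.h2b])
      (by simp [Derivation.commutator_apply, h1γ, h2γ]) hδM
    rw [Derivation.commutator_apply] at this
    exact sub_eq_zero.1 this
  have s1 : D1 (D1 δ) = D1 δ := der_eq_of_mem (D := sqD D1) (D' := D1) (α := α) (β := β) (γ := γ)
      (by simp [sqD_apply, hd.h1a]) (by simp [sqD_apply, hd.h1b]) (by simp [sqD_apply, h1γ]) hδM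
  have s2' : D2 (D2 δ) = D2 δ := der_eq_of_mem (D := sqD D2) (D' := D2) (α := α) (β := β) (γ := γ)
      (by simp [sqD_apply, hd.h2a]) (by simp [sqD_apply, hd.h2b]) (by simp [sqD_apply, h2γ]) hδM
  -- the derivation X
  set X : Derivation ℤ F F := (D2 δ * δ⁻¹) • D1 + (D1 δ * δ⁻¹) • D2 + Γ with hX
  have Xap : ∀ z, X z = D2 δ * δ⁻¹ * D1 z + D1 δ * δ⁻¹ * D2 z + Γ z := fun z => by
    simp [hX]
  have Xα : X α = D2 δ * δ⁻¹ * α := by rw [Xap, hd.h1a, hd.h2a, hΓα]; ring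
  have Xβ : X β = D1 δ * δ⁻¹ * β := by rw [Xap, hd.h1b, hd.h2b, hΓβ]; ring
  have Xγ : X γ = γ := by rw [Xap, h1γ, h2γ, hΓγ]; ring
  obtain ⟨Xa, Xb⟩ : X a = 0 ∧ X b = 0 := by
    apply hS
    · apply div_zero_num hab
      rw [hom, Xα, Xβ, Xγ, hd.h1a, hd.h1b, h1γ]
      field_simp; ring
    · apply div_zero_num hab
      rw [hom, Xα, Xβ, Xγ, hd.h2a, hd.h2b, h2γ]
      field_simp
      linear_combination α * γ * D2 δ * hc2
  have hN : Fsq F ≤ adj (LL a b) γ := (Fsq_le_LL _ _).trans (le_adj _ _)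
  have ma : a ∈ adj (LL a b) γ := le_adj _ _ (left_mem_LL _ _)
  have mb : b ∈ adj (LL a b) γ := le_adj _ _ (right_mem_LL _ _)
  have mγ' : γ ∈ adj (LL a b) γ := self_mem_adj _ _
  have nα : α ∈ adj (LL a b) γ := by
    by_contra hc
    obtain ⟨E, hE, hE1⟩ := exists_der hN hc
    have e1 := hom E D2
    rw [hE _ ma, hE _ mb, hE _ mγ', h2γ, hE1, hd.h2a, hd.h2b] at e1
    have e4 : β / (α * β) = (0 * D2 b - D2 a * 0) / (a * b) := by rw [e1]; ring
    rw [zero_mul, mul_zero, sub_zero, zero_div] at e4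
    exact hβ (div_zero_num (mul_ne_zero hα hβ) e4)
  have nβ : β ∈ adj (LL a b) γ := by
    by_contra hc
    obtain ⟨E, hE, hE1⟩ := exists_der hN hc
    have e1 := hom E D1
    rw [hE _ ma, hE _ mb, hE _ mγ', h1γ, hE1, hd.h1a, hd.h1b] at e1
    have e4 : -(α / (α * β)) = (0 * D1 b - D1 a * 0) / (a * b) := by rw [e1]; ring
    rw [zero_mul, mul_zero, sub_zero, zero_div, neg_eq_zero] at e4
    exact hα (div_zero_num (mul_ne_zero hα hβ) e4)
  have XX : ∀ z ∈ adj (LL a b) γ, X (X z) = X z := fun z hz =>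
    der_eq_of_mem (D := sqD X) (D' := X) (α := a) (β := b) (γ := γ)
      (by simp [sqD_apply, Xa]) (by simp [sqD_apply, Xb]) (by simp [sqD_apply, Xγ]) hz
  have x2 := XX α nα
  have x1 := XX β nβ
  refine ⟨hδM, ?_, ?_⟩
  · rw [Xβ, der_mul, Xβ, Xap] at x1
    simp only [der_mul, der_inv, s1] at x1
    rw [comm]
    field_simp at x1
    apply mul_left_cancel₀ hδ
    linear_combination x1 + (D1 δ * δ ^ 2 + D1 δ * δ * Γ δ - δ ^ 2 * Γ (D1 δ) + (D1 δ) ^ 2 * D2 δ) * hc2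
  · rw [Xα, der_mul, Xα, Xap] at x2
    simp only [der_mul, der_inv, s2', comm] at x2
    rw [comm]
    field_simp at x2
    apply mul_left_cancel₀ hδ
    linear_combination x2 + (D2 δ * δ ^ 2 + D2 δ * δ * Γ δ - δ ^ 2 * Γ (D2 δ) + (D2 δ) ^ 2 * D1 δ) * hc2

lemma exists_triple {α β γ : F} (h : NT α β) (hγ : γ ∉ LL α β) : ∃ D1 D2 Γ : Derivation ℤ F F,
    Dual α β D1 D2 ∧ (∀ z ∈ LL α β, Γ z = 0) ∧ Γ γ = γ ∧ D1 γ = 0 ∧ D2 γ = 0 := by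
  obtain ⟨D1, D2, hd⟩ := exists_dual h
  obtain ⟨G, hG, hG1⟩ := exists_der (Fsq_le_LL α β) hγ
  have g1 := hG α (left_mem_LL _ _)
  have g2 := hG β (right_mem_LL _ _)
  refine ⟨D1 - (D1 γ) • G, D2 - (D2 γ) • G, γ • G, ⟨hd.ha, hd.hb, ?_, ?_, ?_, ?_⟩, ?_, ?_, ?_, ?_⟩
  · simp [hd.h1a, g1]
  · simp [hd.h1b, g2]
  · simp [hd.h2a, g1]
  · simp [hd.h2b, g2]
  · intro z hz; simp [hG z hz]
  · simp [hG1]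
  · simp [hG1]
  · simp [hG1]

lemma mem_Fsq_of_dual {α β : F} {D1 D2 : Derivation ℤ F F} (h : Dual α β D1 D2) {z : F}
    (hz : z ∈ LL α β) (h1 : D1 z = 0) (h2 : D2 z = 0) : z ∈ Fsq F := by
  obtain ⟨c0, c1, c2, c3, e, e0⟩ := h.pr_sq hz
  rw [pr, h1, h2, map_zero, add_zero, add_zero, add_zero] at e0
  rw [e0]; exact sq_mem_Fsq _

/-- first slot step : a slot of `{γ,δ}` in `F²(α,β)` -/
lemma slot_in_L {α β γ δ a b : F} (h1 : NT α β) (h2 : NT γ δ) (hγ : γ ∉ LL α β)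
    (ha : a ≠ 0) (hb : b ≠ 0) (h : ka a b = ka α β + ka γ δ) :
    ∃ u v, u ∈ LL α β ∧ u ≠ 0 ∧ v ≠ 0 ∧ ka γ δ = ka u v := by
  obtain ⟨D1, D2, Γ, hd, hΓ, hΓγ, h1γ, h2γ⟩ := exists_triple h1 hγ
  obtain ⟨hδM, r1, r2⟩ := lemmaR hd hΓ hΓγ h1γ h2γ h2.ha h2.hb ha hb h
  have hc2 : (2 : F) = 0 := CharTwo.two_eq_zero
  have hγ0 := h2.ha
  obtain ⟨p, hp, q, hq, eδ⟩ := (mem_adj (sq_mem_LL α β γ)).1 hδM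
  have f1 : D1 δ = D1 p + D1 q * γ := by rw [eδ, map_add, der_mul, h1γ]; ring
  have f2 : D2 δ = D2 p + D2 q * γ := by rw [eδ, map_add, der_mul, h2γ]; ring
  have g1 : Γ (D1 δ) = D1 q * γ := by
    rw [f1, map_add, der_mul, hΓγ, hΓ _ (hd.D_mem hp).1, hΓ _ (hd.D_mem hq).1]; ring
  have g2 : Γ (D2 δ) = D2 q * γ := by
    rw [f2, map_add, der_mul, hΓγ, hΓ _ (hd.D_mem hp).2, hΓ _ (hd.D_mem hq).2]; ring
  have key : D1 p * D2 q = D2 p * D1 q := by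
    have e1 : δ * (D2 δ * Γ (D1 δ)) = δ * (D1 δ * Γ (D2 δ)) := by
      linear_combination D1 δ * r2 - D2 δ * r1
    have e2 := mul_left_cancel₀ h2.hb e1
    rw [g1, g2, f1, f2] at e2
    apply mul_right_cancel₀ hγ0
    linear_combination -e2
  have hpq : p ∈ Fsq F ∨ q ∈ adj (Fsq F) p := by
    by_contra hcon
    push Not at hcon
    obtain ⟨E, hE, hE1⟩ := exists_der (le_adj _ _) hcon.2
    have hEp := hE p (self_mem_adj _ _)
    have hEz : ∀ z ∈ LL α β, E z = D1 z * (E α * α⁻¹) + D2 z * (E β * β⁻¹) := by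
      intro z hz
      have := der_eq_of_mem (D := E) (D' := (E α * α⁻¹) • D1 + (E β * β⁻¹) • D2) (α := α) (β := β)
        (γ := α) (z := z) (by simp [hd.h1a, hd.h2a, hd.ha]) (by simp [hd.h1b, hd.h2b, hd.hb])
        (by simp [hd.h1a, hd.h2a, hd.ha]) (le_adj _ _ hz)
      rw [this]; simp; ring
    have x1 := hEz p hp
    have x2 := hEz q hq
    rw [hEp] at x1
    rw [hE1] at x2
    apply hcon.1
    apply mem_Fsq_of_dual hd hp
    · linear_combination D1 p * x2 - D1 q * x1 + (E β * β⁻¹) * key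
    · linear_combination D2 p * x2 - D2 q * x1 - (E α * α⁻¹) * key
  have m := sq_mem_LL α β
  rcases hpq with hp' | hq'
  · obtain ⟨s, rfl⟩ := mem_Fsq.1 hp'
    have hne := slot_ne (c1 := s) (c2 := 0) (c3 := 1) h2 (Or.inr one_ne_zero)
    obtain ⟨y, hy, e⟩ := slot_lemma h2.ha h2.hb hne rfl
    refine ⟨_, y, ?_, hne, hy, e⟩
    have e1 : s ^ 2 * γ + 0 ^ 2 * δ + 1 ^ 2 * (γ * δ) = q * γ ^ 2 := by
      rw [eδ]; linear_combination s ^ 2 * γ * hc2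
    rw [e1]; exact mul_mem hq (m _)
  · obtain ⟨s', hs, r', hr, eq⟩ := (mem_adj (sq_mem_Fsq p)).1 hq'
    obtain ⟨s, rfl⟩ := mem_Fsq.1 hs
    obtain ⟨r, rfl⟩ := mem_Fsq.1 hr
    have hne := slot_ne (c1 := s) (c2 := 1) (c3 := r) h2 (Or.inl one_ne_zero)
    obtain ⟨y, hy, e⟩ := slot_lemma h2.ha h2.hb hne rfl
    refine ⟨_, y, ?_, hne, hy, e⟩
    have e1 : s ^ 2 * γ + 1 ^ 2 * δ + r ^ 2 * (γ * δ) = p + r ^ 2 * γ ^ 2 * q := by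
      rw [eδ]; linear_combination γ * eq + (s ^ 2 * γ + r ^ 2 * p * γ) * hc2
    rw [e1]; exact add_mem hp (mul_mem (mul_mem (m _) (m _)) hq)

lemma common_slot_aux {α β γ δ a b : F} (h1 : NT α β) (h2 : NT γ δ) (hγ : γ ∉ LL α β)
    (ha : a ≠ 0) (hb : b ≠ 0) (h : ka a b = ka α β + ka γ δ) :
    ∃ u v1 v2, u ≠ 0 ∧ v1 ≠ 0 ∧ v2 ≠ 0 ∧ ka α β = ka u v1 ∧ ka γ δ = ka u v2 := by
  obtain ⟨u, v, hu, hu0, hv0, e⟩ := slot_in_L h1 h2 hγ ha hb h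
  have h3 : NT u v := NT_iff.2 (e ▸ h2.ne)
  have hv : v ∉ LL α β := by
    intro hv
    obtain ⟨E1, E2, hd⟩ := exists_dual h3
    exact hγ (LL_le (Fsq_le_LL _ _) hu hv (hd.left_mem h2.ha h2.hb e))
  obtain ⟨D1, D2, Γ, hd, hΓ, hΓγ, h1γ, h2γ⟩ := exists_triple h1 hv
  obtain ⟨-, r1, r2⟩ := lemmaR hd hΓ hΓγ h1γ h2γ hv0 hu0 ha hb
    (by rw [h, e, ka_swap u v])
  rw [hΓ _ (hd.D_mem hu).1, hΓ u hu, mul_zero, add_zero] at r1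
  rw [hΓ _ (hd.D_mem hu).2, hΓ u hu, mul_zero, add_zero] at r2
  have hp : pr D1 D2 u = 0 := by
    rcases mul_eq_zero.1 r1 with x1 | x1
    · rcases mul_eq_zero.1 r2 with x2 | x2
      · exact absurd (mem_Fsq_of_dual hd hu x1 x2) h3.1
      · exact x2
    · exact x1
  obtain ⟨c1, c2, c3, eu⟩ := hd.pr_zero hu hp
  obtain ⟨y, hy, e'⟩ := slot_lemma h1.ha h1.hb hu0 eu
  exact ⟨u, y, v, hu0, hy, hv0, e', e⟩

lemma common_slot {α β γ δ a b : F} (h1 : NT α β) (h2 : NT γ δ)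
    (ha : a ≠ 0) (hb : b ≠ 0) (h : ka a b = ka α β + ka γ δ) :
    ∃ u v1 v2, u ≠ 0 ∧ v1 ≠ 0 ∧ v2 ≠ 0 ∧ ka α β = ka u v1 ∧ ka γ δ = ka u v2 := by
  by_cases hγ : γ ∈ LL α β
  swap
  · exact common_slot_aux h1 h2 hγ ha hb h
  by_cases hδ : δ ∈ LL α β
  swap
  · have h2' : NT δ γ := NT_iff.2 (by rw [ka_swap]; exact h2.ne)
    obtain ⟨u, v1, v2, x1, x2, x3, x4, x5⟩ := common_slot_aux h1 h2' hδ ha hb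
      (by rw [h, ka_swap γ])
    exact ⟨u, v1, v2, x1, x2, x3, x4, by rw [ka_swap, x5]⟩
  obtain ⟨D1, D2, hd⟩ := exists_dual h1
  obtain ⟨c0, c1, c2, c3, -, e0⟩ := hd.pr_sq hγ
  obtain ⟨d0, d1, d2, d3, -, f0⟩ := hd.pr_sq hδ
  by_cases hc : c0 = 0
  · obtain ⟨x1, x2, x3, eu⟩ := hd.pr_zero hγ (by rw [e0, hc]; ring)
    obtain ⟨y, hy, e'⟩ := slot_lemma h1.ha h1.hb h2.ha eu
    exact ⟨γ, y, δ, h2.ha, hy, h2.hb, e', rfl⟩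
  · have hne := slot_ne (c1 := d0) (c2 := c0) (c3 := 0) h2 (Or.inl hc)
    obtain ⟨y, hy, e⟩ := slot_lemma h2.ha h2.hb hne rfl
    have e1 : d0 ^ 2 * γ + c0 ^ 2 * δ + 0 ^ 2 * (γ * δ) = d0 ^ 2 * γ + c0 ^ 2 * δ := by ring
    rw [e1] at hne e
    have hp : pr D1 D2 (d0 ^ 2 * γ + c0 ^ 2 * δ) = 0 := by
      rw [pr_add, pr_sq_mul, pr_sq_mul, e0, f0, mul_comm, CharTwo.add_self_eq_zero]
    have m := sq_mem_LL α β
    obtain ⟨x1, x2, x3, eu⟩ := hd.pr_zero (add_mem (mul_mem (m d0) hγ) (mul_mem (m c0) hδ)) hp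
    obtain ⟨y', hy', e'⟩ := slot_lemma h1.ha h1.hb hne eu
    exact ⟨_, y', y, hne, hy', hy, e', e⟩

lemma pair_cost {a b c d : F} (ha : a ≠ 0) (hb : b ≠ 0) (hc : c ≠ 0) (hd : d ≠ 0)
    (h : ka a b + ka c d = 0) : Cost 5 (sf a b + sf c d) := by
  have := pair_lemma ha hb (inv_ne_zero hc) hd (by rw [ka_inv_left]; exact q_eq_of_add h)
  rwa [sf_inv_left, sub_neg_eq_add] at this

/-- three symbols summing to zero mod 2 -/
theorem three_cost {α β γ δ a b : F} (hα : α ≠ 0) (hβ : β ≠ 0) (hγ : γ ≠ 0) (hδ : δ ≠ 0)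
    (ha : a ≠ 0) (hb : b ≠ 0) (h : ka α β + ka γ δ + ka a b = 0) :
    Cost 15 (sf α β + sf γ δ + sf a b) := by
  by_cases h1 : ka α β = 0
  · rw [h1, zero_add] at h
    rw [add_assoc]
    exact Cost_mono (by norm_num) (Cost_add (triv_cost' h1) (pair_cost hγ hδ ha hb h))
  by_cases h2 : ka γ δ = 0
  · rw [h2, add_zero] at h
    rw [add_right_comm]
    exact Cost_mono (by norm_num) (Cost_add (pair_cost hα hβ ha hb h) (triv_cost' h2))
  have h' : ka a b = ka α β + ka γ δ := (q_eq_of_add h).symm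
  obtain ⟨u, v1, v2, hu, hv1, hv2, e1, e2⟩ := common_slot (NT_iff.2 h1) (NT_iff.2 h2) ha hb h'
  have hv : (v1 * v2)⁻¹ ≠ 0 := inv_ne_zero (mul_ne_zero hv1 hv2)
  have c1 := pair_lemma hα hβ hu hv1 e1
  have c2 := pair_lemma hγ hδ hu hv2 e2
  have c3 := pair_lemma ha hb hu hv (by
    rw [ka_inv_right, ka_mul_right _ hv1 hv2, h', e1, e2])
  have := Cost_add (Cost_add c1 c2) c3
  convert this using 1
  rw [sf_inv_right, sf_mul_right _ hv1 hv2]; abel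

end CommonSlot

end Milnor

namespace Milnor

section Tower

variable {F : Type*} [Field F] [CharP F 2]

/-- symbols with first entry in `C` and second in `M`, symbols in `B`, and `2 K₂` -/
def UU (C B M : Subfield F) : AddSubgroup (K F 2) :=
  AddSubgroup.closure ({t | ∃ c ∈ C, ∃ m ∈ M, t = sf c m} ∪ {t | ∃ b ∈ B, ∃ b' ∈ B, t = sf b b'} ∪
    {t | t ∈ M2 F})

lemma UU_left {C B M : Subfield F} {c m : F} (hc : c ∈ C) (hm : m ∈ M) : sf c m ∈ UU C B M :=
  AddSubgroup.subset_closure (Or.inl (Or.inl ⟨c, hc, m, hm, rfl⟩))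

lemma UU_right {C B M : Subfield F} {c m : F} (hc : c ∈ B) (hm : m ∈ B) : sf c m ∈ UU C B M :=
  AddSubgroup.subset_closure (Or.inl (Or.inr ⟨c, hc, m, hm, rfl⟩))

lemma UU_M2 {C B M : Subfield F} {t : K F 2} (h : t ∈ M2 F) : t ∈ UU C B M :=
  AddSubgroup.subset_closure (Or.inr h)

lemma UU_le {C B M : Subfield F} {S : AddSubgroup (K F 2)} (h1 : ∀ c ∈ C, ∀ m ∈ M, sf c m ∈ S)
    (h2 : ∀ c ∈ B, ∀ m ∈ B, sf c m ∈ S) (h3 : M2 F ≤ S) : UU C B M ≤ S := by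
  rw [UU, AddSubgroup.closure_le]
  rintro t ((⟨c, hc, m, hm, rfl⟩ | ⟨c, hc, m, hm, rfl⟩) | h)
  · exact h1 c hc m hm
  · exact h2 c hc m hm
  · exact h3 h

lemma UU_mono {C B M C' B' M' : Subfield F} (h1 : C ≤ C') (h2 : B ≤ B') (h3 : M ≤ M') :
    UU C B M ≤ UU C' B' M' :=
  UU_le (fun _ hc _ hm => UU_left (h1 hc) (h3 hm)) (fun _ hc _ hm => UU_right (h2 hc) (h2 hm))
    (fun _ h => UU_M2 h)

lemma UU_swap {C B M : Subfield F} {c m : F} (hc : c ∈ C) (hm : m ∈ M) : sf m c ∈ UU C B M := by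
  rw [sf_swap]; exact neg_mem (UU_left hc hm)

/-- write an element of `adj C x` outside `C` as `q (x + c)` -/
lemma adj_form {C : Subfield F} {x : F} (hx : x ^ 2 ∈ C) {u : F} (hu : u ∈ adj C x) (huC : u ∉ C) :
    ∃ q ∈ C, ∃ c ∈ C, q ≠ 0 ∧ u = q * (x + c) := by
  obtain ⟨p, hp, q, hq, rfl⟩ := (mem_adj hx).1 hu
  have hq0 : q ≠ 0 := by rintro rfl; apply huC; simpa using hp
  exact ⟨q, hq, p * q⁻¹, mul_mem hp (inv_mem hq), hq0, by field_simp; ring⟩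

lemma tower_a {B : Subfield F} {x : F} (hB : Fsq F ≤ B) {m m' : F} (hm : m ∈ adj B x)
    (hm' : m' ∈ adj B x) : sf m m' ∈ UU B B (adj B x) := by
  by_cases h1 : m ∈ B
  · exact UU_left h1 hm'
  by_cases h2 : m' ∈ B
  · exact UU_swap h2 hm
  have hx2 : x ^ 2 ∈ B := hB (sq_mem_Fsq x)
  have hxm := self_mem_adj B x
  have hle := le_adj B x
  obtain ⟨q, hq, c, hc, hq0, rfl⟩ := adj_form hx2 hm h1
  obtain ⟨q', hq', d, hd, hq0', rfl⟩ := adj_form hx2 hm' h2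
  have n1 : x + c ≠ 0 := by intro h; apply h1; rw [h, mul_zero]; exact zero_mem _
  have n2 : x + d ≠ 0 := by intro h; apply h2; rw [h, mul_zero]; exact zero_mem _
  have m1 : x + c ∈ adj B x := add_mem hxm (hle hc)
  have m2 : x + d ∈ adj B x := add_mem hxm (hle hd)
  rw [sf_mul_left _ hq0 n1, sf_mul_right (x + c) hq0' n2]
  refine add_mem (UU_left hq hm') (add_mem (UU_swap hq' m1) ?_)
  by_cases hcd : c = d
  · rw [hcd, sf_self]; exact zero_mem _
  have e : (x + c) + (x + d) = c + d := by
    have h2 : (2 : F) = 0 := CharTwo.two_eq_zero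
    linear_combination x * h2
  rw [sf_add n1 n2 (add_ne_of_ne hcd) e]
  exact add_mem (UU_swap (add_mem hc hd) m1) (UU_left (add_mem hc hd) m2)

lemma ka_identity {X z : F} (hX : X ≠ 0) (hX1 : X + 1 ≠ 0) (hz : z ≠ 0) (hz1 : 1 + z ≠ 0)
    (hXz : X + z ≠ 0) (hW : X + z ^ 2 ≠ 0) :
    ka X (1 + z) + ka (X + 1) z =
      ka (X * (X + 1) * (X + z ^ 2)) (z * (1 + z) * (X + z)) := by
  have h2 : (2 : F) = 0 := CharTwo.two_eq_zero
  have hzz := mul_ne_zero hz hz1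
  have i1 := ka_add (a := X + z) (b := z * (1 + z)) (c := X + z ^ 2) hXz hzz hW
    (by linear_combination z * h2)
  have i2 := ka_add (a := X) (b := z) hX hz hXz rfl
  have i3 := ka_add (a := X + 1) (b := 1 + z) (c := X + z) hX1 hz1 hXz (by linear_combination h2)
  rw [ka_mul_left _ (mul_ne_zero hX hX1) hW, ka_mul_left _ hX hX1, ka_mul_right _ hzz hXz,
    ka_mul_right _ hzz hXz, ka_mul_right (X + z ^ 2) hzz hXz, ka_mul_right X hz hz1,
    ka_mul_right (X + 1) hz hz1, i2, i3, ka_swap (X + z ^ 2) (X + z)]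
  rw [ka_mul_right _ hz hz1] at i1
  have i4 : ka (X + z ^ 2) (z * (1 + z)) + ka (X + z) (X + z ^ 2) = ka (X + z) z + ka (X + z) (1 + z) := by
    rw [i1]; abel
  rw [i4]
  have d1 := q_add_self (ka X (X + z))
  have d2 := q_add_self (ka (X + z) z)
  have d3 := q_add_self (ka (X + 1) (X + z))
  have d4 := q_add_self (ka (X + z) (1 + z))
  have : ∀ p q A B C D : K F 2 ⧸ M2 F, A + A = 0 → B + B = 0 → C + C = 0 → D + D = 0 →
      p + q = (A + B + p + A) + (q + (C + D) + C) + (B + D) := by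
    intro p q A B C D a b c d
    have : (A + B + p + A) + (q + (C + D) + C) + (B + D) =
      p + q + (A + A) + (B + B) + (C + C) + (D + D) := by abel
    rw [this, a, b, c, d]; abel
  exact this _ _ _ _ _ _ d1 d2 d3 d4

lemma sf_sub_mem_M2 {x y : K F 2}
    (h : QuotientAddGroup.mk' (M2 F) x = QuotientAddGroup.mk' (M2 F) y) : x - y ∈ M2 F := by
  rw [← sub_eq_zero, ← map_sub] at h
  exact (QuotientAddGroup.eq_zero_iff _).1 h

/-- combine two symbols -/
lemma tower_b {C B : Subfield F} {x' x : F} (hC : Fsq F ≤ C) (hNB : adj C x' ≤ B)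
    {u u' v v' : F} (hu : u ∈ adj C x') (hu' : u' ∈ adj C x') (hv : v ∈ adj B x)
    (hv' : v' ∈ adj B x) : ∃ u'' ∈ adj C x', ∃ v'' ∈ adj B x,
      sf u v + sf u' v' - sf u'' v'' ∈ UU C B (adj B x) := by
  set N := adj C x' with hN
  set M := adj B x with hM
  have hCN : C ≤ N := le_adj _ _
  have hBM : B ≤ M := le_adj _ _
  by_cases h1 : u ∈ C
  · exact ⟨u', hu', v', hv', by rw [add_sub_cancel_right]; exact UU_left h1 hv⟩
  by_cases h2 : u' ∈ C
  · exact ⟨u, hu, v, hv, by rw [add_sub_cancel_left]; exact UU_left h2 hv'⟩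
  by_cases h3 : v ∈ B
  · exact ⟨u', hu', v', hv', by rw [add_sub_cancel_right]; exact UU_right (hNB hu) h3⟩
  by_cases h4 : v' ∈ B
  · exact ⟨u, hu, v, hv, by rw [add_sub_cancel_left]; exact UU_right (hNB hu') h4⟩
  have c2 : (2 : F) = 0 := CharTwo.two_eq_zero
  obtain ⟨q, hq, c1, hc1, hq0, rfl⟩ := adj_form (hC (sq_mem_Fsq x')) hu h1
  obtain ⟨q', hq', c1', hc1', hq0', rfl⟩ := adj_form (hC (sq_mem_Fsq x')) hu' h2
  have hB : Fsq F ≤ B := hC.trans (hCN.trans hNB)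
  obtain ⟨r, hr, d1, hd1, hr0, rfl⟩ := adj_form (hB (sq_mem_Fsq x)) hv h3
  obtain ⟨r', hr', d1', hd1', hr0', rfl⟩ := adj_form (hB (sq_mem_Fsq x)) hv' h4
  obtain ⟨y, hy⟩ : ∃ y, y = x + d1 := ⟨_, rfl⟩
  obtain ⟨w, hw⟩ : ∃ w, w = x' + c1 := ⟨_, rfl⟩
  obtain ⟨d, hd⟩ : ∃ d, d = c1 + c1' := ⟨_, rfl⟩
  obtain ⟨c, hc⟩ : ∃ c, c = d1 + d1' := ⟨_, rfl⟩
  have ew : x' + c1' = w + d := by rw [hw, hd]; linear_combination -c1 * c2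
  have ey : x + d1' = y + c := by rw [hy, hc]; linear_combination -d1 * c2
  have hdC : d ∈ C := by rw [hd]; exact add_mem hc1 hc1'
  have hcB : c ∈ B := by rw [hc]; exact add_mem hd1 hd1'
  rw [← hw] at hu h1 ⊢
  rw [← hy] at hv h3 ⊢
  rw [ew] at hu' h2 ⊢
  rw [ey] at hv' h4 ⊢
  have nw : w ≠ 0 := by rintro h; apply h1; rw [h, mul_zero]; exact zero_mem _
  have nwd : w + d ≠ 0 := by intro h; apply h2; rw [h, mul_zero]; exact zero_mem _
  have ny : y ≠ 0 := by rintro h; apply h3; rw [h, mul_zero]; exact zero_mem _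
  have nyc : y + c ≠ 0 := by intro h; apply h4; rw [h, mul_zero]; exact zero_mem _
  have wN : w ∈ N := by rw [hw]; exact add_mem (self_mem_adj _ _) (hCN hc1)
  have yM : y ∈ M := by rw [hy]; exact add_mem (self_mem_adj _ _) (hBM hd1)
  have wdN : w + d ∈ N := add_mem wN (hCN hdC)
  have ycM : y + c ∈ M := add_mem yM (hBM hcB)
  have wC : w ∉ C := fun h => h1 (mul_mem hq h)
  have yB : y ∉ B := fun h => h3 (mul_mem hr h)
  suffices h : ∃ u'' ∈ N, ∃ v'' ∈ M, sf w y + sf (w + d) (y + c) - sf u'' v'' ∈ UU C B M by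
    obtain ⟨u'', hu'', v'', hv'', h⟩ := h
    refine ⟨u'', hu'', v'', hv'', ?_⟩
    rw [sf_mul_left _ hq0 nw, sf_mul_left _ hq0' nwd, sf_mul_right w hr0 ny,
      sf_mul_right (w + d) hr0' nyc]
    have := add_mem (add_mem (add_mem (UU_left (B := B) hq hv) (UU_left (B := B) hq' hv'))
      (add_mem (UU_right (C := C) (M := M) (hNB wN) hr) (UU_right (C := C) (M := M) (hNB wdN) hr'))) h
    convert this using 1; abel
  by_cases hd0 : d = 0
  · refine ⟨w, wN, y * (y + c), mul_mem yM ycM, ?_⟩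
    rw [sf_mul_right _ ny nyc, hd0, add_zero, sub_self]; exact zero_mem _
  by_cases hc0 : c = 0
  · refine ⟨w * (w + d), mul_mem wN wdN, y, yM, ?_⟩
    rw [sf_mul_left _ nw nwd, hc0, add_zero, sub_self]; exact zero_mem _
  obtain ⟨X, hX⟩ : ∃ X, X = w * d⁻¹ := ⟨_, rfl⟩
  obtain ⟨z, hz⟩ : ∃ z, z = 1 + y * c⁻¹ := ⟨_, rfl⟩
  have e1 : w = d * X := by rw [hX]; field_simp
  have e2 : w + d = d * (X + 1) := by rw [hX]; field_simp
  have e3 : y = c * (1 + z) := by rw [hz]; field_simp; linear_combination -c * c2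
  have e4 : y + c = c * z := by rw [hz]; field_simp; ring
  have nX : X ≠ 0 := by intro h; apply nw; rw [e1, h, mul_zero]
  have nX1 : X + 1 ≠ 0 := by intro h; apply nwd; rw [e2, h, mul_zero]
  have nz : z ≠ 0 := by intro h; apply nyc; rw [e4, h, mul_zero]
  have nz1 : 1 + z ≠ 0 := by intro h; apply ny; rw [e3, h, mul_zero]
  have XN : X ∈ N := by rw [hX]; exact mul_mem wN (inv_mem (hCN hdC))
  have zM : z ∈ M := by rw [hz]; exact add_mem (one_mem _) (mul_mem yM (inv_mem (hBM hcB)))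
  have XC : X ∉ C := fun h => wC (by rw [e1]; exact mul_mem hdC h)
  have zB : z ∉ B := fun h => yB (by rw [e3]; exact mul_mem hcB (add_mem (one_mem _) h))
  have nXz : X + z ≠ 0 := by
    intro h
    apply zB
    rw [← CharTwo.add_eq_zero.1 h]; exact hNB XN
  have nW : X + z ^ 2 ≠ 0 := by
    intro h
    apply XC
    rw [CharTwo.add_eq_zero.1 h]; exact hC (sq_mem_Fsq z)
  refine ⟨X * (X + 1) * (X + z ^ 2), mul_mem (mul_mem XN (add_mem XN (one_mem _)))
    (add_mem XN (hCN (hC (sq_mem_Fsq z)))), z * (1 + z) * (X + z),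
    mul_mem (mul_mem zM (add_mem (one_mem _) zM)) (add_mem (hBM (hNB XN)) zM), ?_⟩
  have hid : sf X (1 + z) + sf (X + 1) z -
      sf (X * (X + 1) * (X + z ^ 2)) (z * (1 + z) * (X + z)) ∈ M2 F := by
    apply sf_sub_mem_M2
    rw [map_add]
    exact ka_identity nX nX1 nz nz1 nXz nW
  have f1 : sf w y = sf d y + (sf X c + sf X (1 + z)) := by
    rw [← sf_mul_right X hc0 nz1, ← e3, ← sf_mul_left y hd0 nX, ← e1]
  have f2 : sf (w + d) (y + c) = sf d (y + c) + (sf (X + 1) c + sf (X + 1) z) := by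
    rw [← sf_mul_right (X + 1) hc0 nz, ← e4, ← sf_mul_left (y + c) hd0 nX1, ← e2]
  rw [f1, f2]
  have := add_mem (add_mem (add_mem (UU_left (B := B) hdC yM) (UU_left (B := B) hdC ycM))
      (add_mem (UU_right (C := C) (M := M) (hNB XN) hcB)
        (UU_right (C := C) (M := M) (add_mem (hNB XN) (one_mem _)) hcB)))
      (UU_M2 (C := C) (B := B) (M := M) hid)
  convert this using 1; abel

lemma tower_c {C B : Subfield F} {x' x : F} (hC : Fsq F ≤ C) (hNB : adj C x' ≤ B) {t : K F 2}
    (ht : t ∈ UU (adj C x') B (adj B x)) : ∃ u ∈ adj C x', ∃ v ∈ adj B x,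
      t - sf u v ∈ UU C B (adj B x) := by
  induction ht using AddSubgroup.closure_induction with
  | mem t ht =>
    rcases ht with (⟨c, hc, m, hm, rfl⟩ | ⟨c, hc, m, hm, rfl⟩) | h
    · exact ⟨c, hc, m, hm, by rw [sub_self]; exact zero_mem _⟩
    · exact ⟨1, one_mem _, 1, one_mem _, by rw [sf_one_left, sub_zero]; exact UU_right hc hm⟩
    · exact ⟨1, one_mem _, 1, one_mem _, by rw [sf_one_left, sub_zero]; exact UU_M2 h⟩
  | zero => exact ⟨1, one_mem _, 1, one_mem _, by rw [sf_one_left, sub_zero]; exact zero_mem _⟩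
  | add s t _ _ hs ht =>
    obtain ⟨u, hu, v, hv, h⟩ := hs
    obtain ⟨u', hu', v', hv', h'⟩ := ht
    obtain ⟨u'', hu'', v'', hv'', h''⟩ := tower_b hC hNB hu hu' hv hv'
    refine ⟨u'', hu'', v'', hv'', ?_⟩
    convert add_mem (add_mem h h') h'' using 1; abel
  | neg s _ hs =>
    obtain ⟨u, hu, v, hv, h⟩ := hs
    refine ⟨u⁻¹, inv_mem hu, v, hv, ?_⟩
    rw [sf_inv_left]
    convert neg_mem h using 1; abel

/-- tower attached to a list -/
def tow : List F → Subfield F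
  | [] => Fsq F
  | x :: l => adj (tow l) x

lemma Fsq_le_tow (l : List F) : Fsq F ≤ tow l := by
  induction l with
  | nil => exact le_rfl
  | cons x l ih => exact ih.trans (le_adj _ _)

/-- leading term exists -/
def Lead (T : K F 2) : Prop := ∃ (A B : Subfield F) (u v : F), Fsq F ≤ A ∧ A ≤ B ∧ u ∈ B ∧ u ∉ A ∧
  v ∉ B ∧ T - sf u v ∈ UU A B ⊤

lemma tower_inner (B : Subfield F) (x : F) (T : K F 2) (l : List F) (hl : tow l ≤ B)
    (hT : T ∈ UU (tow l) B (adj B x)) : T ∈ UU (Fsq F) B (adj B x) ∨ Lead T := by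
  induction l with
  | nil => exact Or.inl hT
  | cons x' l ih =>
    have hC := Fsq_le_tow l
    have hlB : tow l ≤ B := (le_adj _ _).trans hl
    obtain ⟨u, hu, v, hv, h⟩ := tower_c hC hl hT
    by_cases h1 : u ∈ tow l
    · apply ih hlB
      have := add_mem h (UU_left (B := B) h1 hv)
      rwa [sub_add_cancel] at this
    by_cases h2 : v ∈ B
    · apply ih hlB
      have := add_mem h (UU_right (C := tow l) (M := adj B x) (hl hu) h2)
      rwa [sub_add_cancel] at this
    exact Or.inr ⟨tow l, B, u, v, hC, hlB, hl hu, h1, h2, UU_mono le_rfl le_rfl le_top h⟩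

lemma UU_Fsq_le {B M : Subfield F} : UU (Fsq F) B M ≤ UU B B B := by
  refine UU_le ?_ (fun _ hc _ hm => UU_right hc hm) (fun _ h => UU_M2 h)
  intro c hc m hm
  obtain ⟨g, rfl⟩ := mem_Fsq.1 hc
  exact UU_M2 (mem_M2.2 ⟨_, sf_sq_left g m⟩)

lemma tower_outer (T : K F 2) (l : List F) (hT : T ∈ UU (tow l) (tow l) (tow l)) :
    T ∈ M2 F ∨ Lead T := by
  induction l with
  | nil =>
    left
    refine UU_le ?_ ?_ le_rfl hT
    all_goals
      intro c hc m hm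
      obtain ⟨g, rfl⟩ := mem_Fsq.1 hc
      exact mem_M2.2 ⟨_, sf_sq_left g m⟩
  | cons x l ih =>
    have hT2 : T ∈ UU (tow l) (tow l) (adj (tow l) x) := by
      refine UU_le ?_ ?_ (fun _ h => UU_M2 h) hT
      · exact fun c hc m hm => tower_a (Fsq_le_tow l) hc hm
      · exact fun c hc m hm => tower_a (Fsq_le_tow l) hc hm
    rcases tower_inner _ x T l le_rfl hT2 with h | h
    · exact ih (UU_Fsq_le h)
    · exact Or.inr h

lemma tow_append (l l' : List F) : tow l' ≤ tow (l ++ l') := by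
  induction l with
  | nil => exact le_rfl
  | cons x l ih => exact ih.trans (le_adj _ _)

lemma tow_append' (l l' : List F) : tow l ≤ tow (l ++ l') := by
  induction l with
  | nil => exact Fsq_le_tow _
  | cons x l ih => exact adj_le (ih.trans (le_adj _ _)) (self_mem_adj _ _)

lemma exists_tow (T : K F 2) : ∃ l : List F, T ∈ UU (tow l) (tow l) (tow l) := by
  induction T using sf_induction with
  | h0 => exact ⟨[], zero_mem _⟩
  | hs a b =>
    refine ⟨[a, b], UU_left (self_mem_adj _ _) (le_adj _ _ (self_mem_adj _ _))⟩
  | hadd x y hx hy =>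
    obtain ⟨l, hl⟩ := hx
    obtain ⟨l', hl'⟩ := hy
    have h1 := tow_append l l'
    have h2 := tow_append' l l'
    exact ⟨l ++ l', add_mem (UU_mono h2 h2 h2 hl) (UU_mono h1 h1 h1 hl')⟩

theorem lead_form {T : K F 2} (hT : T ∉ M2 F) : ∃ (k k' : Subfield F) (u v : F), Fsq F ≤ k ∧ k ≤ k' ∧
    u ∈ k' ∧ u ∉ k ∧ v ∉ k' ∧ (∀ l ∈ k', ∃ p ∈ k, ∃ q ∈ k, l = p + q * u) ∧
    (∀ l, ∃ p ∈ k', ∃ q ∈ k', l = p + q * v) ∧ T - sf u v ∈ UU k k' ⊤ := by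
  obtain ⟨l, hl⟩ := exists_tow T
  rcases tower_outer T l hl with h | ⟨A, B, u, v, hA, hAB, huB, huA, hvB, hTU⟩
  · exact absurd h hT
  obtain ⟨k', hBk', -, hvk', hall⟩ := zorn_sub (A := B) (L := ⊤) le_top
    (fun l _ => hAB (hA (sq_mem_Fsq l))) trivial hvB
  obtain ⟨k, hAk, hkk', huk, hall'⟩ := zorn_sub (A := A) (L := k') (hAB.trans hBk')
    (fun l _ => hA (sq_mem_Fsq l)) (hBk' huB) huA
  exact ⟨k, k', u, v, hA.trans hAk, hkk', hBk' huB, huk, hvk', hall', fun l => hall l trivial,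
    UU_mono hAk hBk' le_rfl hTU⟩

end Tower

end Milnor

namespace Milnor

section RootTower

variable {F : Type*} [Field F] [CharP F 2]

lemma sum_range_double {G : Type*} [AddCommMonoid G] (f : ℕ → G) (m : ℕ) :
    ∑ i ∈ Finset.range (2 * m), f i = ∑ i ∈ Finset.range m, (f (2 * i) + f (2 * i + 1)) := by
  induction m with
  | zero => simp
  | succ m ih =>
    rw [Finset.sum_range_succ, ← ih, show 2 * (m + 1) = 2 * m + 1 + 1 by ring,
      Finset.sum_range_succ, Finset.sum_range_succ, add_assoc]

/-- linear independence of the monomials `x^i y^j`, `i, j < M` over `k` -/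
def Uniq (M : ℕ) (k : Subfield F) (x y : F) : Prop := ∀ c : ℕ → ℕ → F, (∀ i j, c i j ∈ k) →
  ∑ i ∈ Finset.range M, ∑ j ∈ Finset.range M, c i j * x ^ i * y ^ j = 0 →
  ∀ i < M, ∀ j < M, c i j = 0

/-- one step of the tower -/
structure State (k k' L : Subfield F) (x y : F) : Prop where
  hk : k ≤ k'
  hk' : k' ≤ L
  hx : x ∈ k'
  hy : y ∈ L
  hxk : x ∉ k
  hyk : y ∉ k'
  hsq : ∀ l ∈ L, l ^ 2 ∈ k
  gx : ∀ l ∈ k', ∃ p ∈ k, ∃ q ∈ k, l = p + q * x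
  gy : ∀ l ∈ L, ∃ p ∈ k', ∃ q ∈ k', l = p + q * y

lemma State.uniq {k k' L : Subfield F} {x y : F} (h : State k k' L x y) {a b c d : F} (ha : a ∈ k)
    (hb : b ∈ k) (hc : c ∈ k) (hd : d ∈ k) (e : a + b * y + c * x + d * x * y = 0) :
    a = 0 ∧ b = 0 ∧ c = 0 ∧ d = 0 := by
  have hk := h.hk
  have hx := h.hx
  obtain ⟨e1, e2⟩ := pq_unique h.hyk (p := a + c * x) (q := b + d * x) (p' := 0) (q' := 0)
    (add_mem (hk ha) (mul_mem (hk hc) hx)) (add_mem (hk hb) (mul_mem (hk hd) hx)) (zero_mem _)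
    (zero_mem _) (by linear_combination e)
  obtain ⟨e3, e4⟩ := pq_unique h.hxk (p' := 0) (q' := 0) ha hc (zero_mem _) (zero_mem _)
    (by linear_combination e1)
  obtain ⟨e5, e6⟩ := pq_unique h.hxk (p' := 0) (q' := 0) hb hd (zero_mem _) (zero_mem _)
    (by linear_combination e2)
  exact ⟨e3, e5, e4, e6⟩

lemma State.gen {k k' L : Subfield F} {x y : F} (h : State k k' L x y) (Q : Subring F)
    (hQ : ∀ z ∈ k, z ∈ Q) (hx : x ∈ Q) (hy : y ∈ Q) : ∀ l ∈ L, l ∈ Q := by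
  have h1 : ∀ z ∈ k', z ∈ Q := by
    intro z hz
    obtain ⟨p, hp, q, hq, rfl⟩ := h.gx z hz
    exact add_mem (hQ p hp) (mul_mem (hQ q hq) hx)
  intro z hz
  obtain ⟨p, hp, q, hq, rfl⟩ := h.gy z hz
  exact add_mem (h1 p hp) (mul_mem (h1 q hq) hy)

/-- the subfield of squares of elements of `k` -/
def sqF (k : Subfield F) : Subfield F := k.map (frobenius F 2)

lemma mem_sqF {k : Subfield F} {z : F} : z ∈ sqF k ↔ ∃ w ∈ k, w ^ 2 = z := by
  rw [sqF, Subfield.mem_map]; rfl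

lemma sq_mem_sqF {k : Subfield F} {z : F} : z ^ 2 ∈ sqF k ↔ z ∈ k := by
  rw [mem_sqF]
  constructor
  · rintro ⟨w, hw, e⟩
    have : w = z := by
      have h1 : (w + z) ^ 2 = 0 := by rw [CharTwo.add_sq, e, CharTwo.add_self_eq_zero]
      have h2 : w + z = 0 := by simpa using h1
      exact CharTwo.add_eq_zero.1 h2
    rwa [← this]
  · exact fun h => ⟨z, h, rfl⟩

lemma State.next {k k' L : Subfield F} {x y : F} (h : State k k' L x y) :
    ∃ k1 k1', State k1 k1' k (x ^ 2) (y ^ 2) := by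
  obtain ⟨k1', h1, h2, h3, h4⟩ := zorn_sub (A := sqF k') (L := k) (x := y ^ 2) (by
    intro z hz
    obtain ⟨w, hw, rfl⟩ := mem_sqF.1 hz
    exact h.hsq w (h.hk' hw)) (fun l hl => sq_mem_sqF.2 (h.hk hl)) (h.hsq y h.hy)
    (fun hy => h.hyk (sq_mem_sqF.1 hy))
  obtain ⟨k1, g1, g2, g3, g4⟩ := zorn_sub (A := sqF k) (L := k1') (x := x ^ 2) (by
    intro z hz
    obtain ⟨w, hw, rfl⟩ := mem_sqF.1 hz
    exact h1 (sq_mem_sqF.2 (h.hk hw))) (fun l hl => sq_mem_sqF.2 (h2 hl))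
    (h1 (sq_mem_sqF.2 h.hx)) (fun hy => h.hxk (sq_mem_sqF.1 hy))
  exact ⟨k1, k1', g2, h2, h1 (sq_mem_sqF.2 h.hx), h.hsq y h.hy, g3, h3,
    fun l hl => g1 (sq_mem_sqF.2 hl), g4, h4⟩

lemma Uniq_step {k k' L k1 : Subfield F} {x y : F} (h : State k k' L x y) {M : ℕ} (hk1 : k1 ≤ k)
    (hu : Uniq M k1 (x ^ 2) (y ^ 2)) : Uniq (2 * M) k1 x y := by
  intro c hc h0
  have hx2 : x ^ 2 ∈ k := h.hsq x (h.hk' h.hx)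
  have hy2 : y ^ 2 ∈ k := h.hsq y h.hy
  set A : ℕ → ℕ → F := fun a b => ∑ i ∈ Finset.range M, ∑ j ∈ Finset.range M,
    c (2 * i + a) (2 * j + b) * (x ^ 2) ^ i * (y ^ 2) ^ j with hA
  have hAk : ∀ a b, A a b ∈ k := fun a b =>
    sum_mem fun i _ => sum_mem fun j _ => mul_mem (mul_mem (hk1 (hc _ _)) (pow_mem hx2 _))
      (pow_mem hy2 _)
  have e : A 0 0 + A 0 1 * y + A 1 0 * x + A 1 1 * x * y = 0 := by
    rw [← h0, sum_range_double]
    simp only [sum_range_double, hA, Finset.sum_mul, ← Finset.sum_add_distrib]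
    refine Finset.sum_congr rfl fun i _ => Finset.sum_congr rfl fun j _ => ?_
    simp only [add_zero]
    ring
  obtain ⟨a00, a01, a10, a11⟩ := h.uniq (hAk 0 0) (hAk 0 1) (hAk 1 0) (hAk 1 1) e
  have hz : ∀ a < 2, ∀ b < 2, A a b = 0 := by
    intro a ha b hb
    interval_cases a <;> interval_cases b <;> assumption
  intro i hi j hj
  have := hu (fun i' j' => c (2 * i' + i % 2) (2 * j' + j % 2)) (fun _ _ => hc _ _)
    (hz (i % 2) (Nat.mod_lt _ two_pos) (j % 2) (Nat.mod_lt _ two_pos)) (i / 2) (by omega) (j / 2)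
    (by omega)
  simpa only [Nat.div_add_mod] using this

lemma Uniq_one (k : Subfield F) (x y : F) : Uniq 1 k x y := by
  intro c hc h0 i hi j hj
  obtain rfl : i = 0 := by omega
  obtain rfl : j = 0 := by omega
  simpa using h0

lemma State.tower (n : ℕ) : ∀ {k k' L : Subfield F} {x y : F}, State k k' L x y →
    ∃ K : Subfield F, K ≤ k ∧ x ^ 2 ^ (n + 1) ∈ K ∧ y ^ 2 ^ (n + 1) ∈ K ∧ Uniq (2 ^ (n + 1)) K x y ∧
      ∀ Q : Subring F, (∀ z ∈ K, z ∈ Q) → x ∈ Q → y ∈ Q → ∀ l ∈ L, l ∈ Q := by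
  induction n with
  | zero =>
    intro k k' L x y h
    refine ⟨k, le_rfl, h.hsq x (h.hk' h.hx), h.hsq y h.hy, Uniq_step h le_rfl (Uniq_one _ _ _), h.gen⟩
  | succ n ih =>
    intro k k' L x y h
    obtain ⟨k1, k1', h1⟩ := h.next
    obtain ⟨K, hK, hx, hy, hu, hg⟩ := ih h1
    refine ⟨K, hK.trans (h1.hk.trans h1.hk'), ?_, ?_, ?_, ?_⟩
    · rw [pow_succ' 2 (n + 1), pow_mul]; exact hx
    · rw [pow_succ' 2 (n + 1), pow_mul]; exact hy
    · rw [pow_succ' 2 (n + 1)]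
      exact Uniq_step h (hK.trans (h1.hk.trans h1.hk')) hu
    · intro Q hQ hxQ hyQ
      exact h.gen Q (hg Q hQ (pow_mem hxQ 2) (pow_mem hyQ 2)) hxQ hyQ

end RootTower

section Witt

lemma exists_witt.{uw} (k : Type uw) [Field k] [CharP k 2] (m : ℕ) :
    ∃ (W : Type uw) (_ : CommRing W) (ε : W →+* k), Function.Surjective ε ∧
      (2 : W) ^ (m + 1) = 0 ∧ (2 : W) ^ m ≠ 0 ∧
      ∀ x y : W, ε x = 0 → ε y = 0 → ∃ z, ε z = 0 ∧ x * y = 2 * z := by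
  have : Fact (Nat.Prime 2) := ⟨Nat.prime_two⟩
  let V := WittVector 2 k
  let I : Ideal V := Ideal.span {(2 : V) ^ (m + 1)}
  have h2 : (2 : k) = 0 := CharTwo.two_eq_zero
  let ε : V ⧸ I →+* k := Ideal.Quotient.lift I (WittVector.constantCoeff : V →+* k) (by
    intro a ha
    obtain ⟨b, rfl⟩ := Ideal.mem_span_singleton.1 ha
    rw [map_mul, map_pow, map_ofNat, h2, zero_pow (Nat.succ_ne_zero _), zero_mul])
  have hε : ∀ a : V, ε (Ideal.Quotient.mk I a) = a.coeff 0 := fun a => rfl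
  refine ⟨V ⧸ I, inferInstance, ε, ?_, ?_, ?_, ?_⟩
  · intro z
    refine ⟨Ideal.Quotient.mk I (WittVector.teichmuller 2 z), ?_⟩
    rw [hε, WittVector.teichmuller_coeff_zero]
  · have : ((2 : V ⧸ I)) ^ (m + 1) = Ideal.Quotient.mk I (2 ^ (m + 1)) := by
      rw [map_pow, map_ofNat]
    rw [this]
    exact Ideal.Quotient.eq_zero_iff_mem.2 (Ideal.mem_span_singleton_self _)
  · have : ((2 : V ⧸ I)) ^ m = Ideal.Quotient.mk I (2 ^ m) := by
      rw [map_pow, map_ofNat]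
    rw [this, Ne, Ideal.Quotient.eq_zero_iff_mem, Ideal.mem_span_singleton]
    rintro ⟨b, hb⟩
    have h1 : ((2 : V) ^ m).coeff m = 1 := by
      have := WittVector.coeff_p_pow (p := 2) (R := k) m
      simpa using this
    have h3 : ((2 : V) ^ (m + 1) * b).coeff m = 0 := by
      have := WittVector.mul_pow_charP_coeff_zero (p := 2) b (Nat.lt_succ_self m)
      rw [mul_comm]
      simpa using this
    rw [hb, h3] at h1
    exact zero_ne_one h1
  · intro x y hx hy
    obtain ⟨x, rfl⟩ := Ideal.Quotient.mk_surjective x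
    obtain ⟨y, rfl⟩ := Ideal.Quotient.mk_surjective y
    rw [hε] at hx hy
    have key : ∀ a : V, a.coeff 0 = 0 → ∃ b, a = WittVector.verschiebung b := by
      intro a ha
      refine ⟨WittVector.mk 2 (fun n => a.coeff (n + 1)), ?_⟩
      ext n
      cases n with
      | zero => rw [ha, WittVector.verschiebung_coeff_zero]
      | succ n => rw [WittVector.verschiebung_coeff_succ]; rfl
    obtain ⟨a, rfl⟩ := key x hx
    obtain ⟨b, rfl⟩ := key y hy
    refine ⟨Ideal.Quotient.mk I (WittVector.verschiebung (a * b)), ?_, ?_⟩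
    · rw [hε, WittVector.verschiebung_coeff_zero]
    · rw [← map_mul]
      have : WittVector.verschiebung a * WittVector.verschiebung b =
          2 * WittVector.verschiebung (a * b) := by
        rw [← WittVector.verschiebung_mul_frobenius, WittVector.frobenius_verschiebung]
        push_cast
        rw [mul_two, mul_add, map_add, two_mul]
      rw [this, map_mul, map_ofNat]

end Witt

end Milnor

namespace Milnor

section Model

/-- lifting data: a ring `S` over `W` with two commuting derivations, lifting `F` -/
structure Model {F W S : Type*} [Field F] [CommRing W] [CommRing S] (ε : W →+* F) (M : ℕ)
    (b1 b2 : F) (w1 w2 : W) where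
  κ : W →+* S
  x : S
  y : S
  D1 : Derivation ℤ S S
  D2 : Derivation ℤ S S
  ρ : S →+ W
  q : S →+* F
  gen : ∀ s : S, s ∈ AddSubmonoid.closure {s : S | ∃ w i j, s = κ w * x ^ i * y ^ j}
  hx : x ^ M = κ w1
  hy : y ^ M = κ w2
  D1κ : ∀ w, D1 (κ w) = 0
  D2κ : ∀ w, D2 (κ w) = 0
  D1x : D1 x = x
  D1y : D1 y = 0
  D2x : D2 x = 0
  D2y : D2 y = y
  ρD1 : ∀ s, ρ (D1 s) = 0
  ρD2 : ∀ s, ρ (D2 s) = 0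
  ρ1 : ρ 1 = 1
  ρκ : ∀ w s, ρ (κ w * s) = w * ρ s
  qκ : ∀ w, q (κ w) = ε w
  qx : q x = b1
  qy : q y = b2

lemma exists_der_quot {R S : Type*} [CommRing R] [CommRing S] (π : R →+* S)
    (hπ : Function.Surjective π) (D : Derivation ℤ R R) (h : ∀ r, π r = 0 → π (D r) = 0) :
    ∃ D' : Derivation ℤ S S, ∀ r, D' (π r) = π (D r) := by
  have hw : ∀ r r', π r = π r' → π (D r) = π (D r') := by
    intro r r' e
    rw [← sub_eq_zero, ← map_sub] at e ⊢
    rw [← map_sub]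
    exact h _ e
  let f : S → S := fun s => π (D (Function.surjInv hπ s))
  have hf : ∀ r, f (π r) = π (D r) := fun r => hw _ _ (Function.surjInv_eq _ _)
  have hadd : ∀ s t, f (s + t) = f s + f t := by
    intro s t
    obtain ⟨s, rfl⟩ := hπ s
    obtain ⟨t, rfl⟩ := hπ t
    rw [← map_add, hf, hf, hf, map_add, map_add]
  refine ⟨Derivation.mk' (AddMonoidHom.mk' f hadd).toIntLinearMap ?_, hf⟩
  intro s t
  change f (s * t) = s • f t + t • f s
  obtain ⟨s, rfl⟩ := hπ s
  obtain ⟨t, rfl⟩ := hπ t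
  rw [← map_mul, hf, hf, hf, Derivation.leibniz, map_add]
  simp only [smul_eq_mul, map_mul]

lemma exists_hom_quot {R S G : Type*} [CommRing R] [CommRing S] [AddCommGroup G] (π : R →+* S)
    (hπ : Function.Surjective π) (f : R →+ G)
    (h : ∀ r, π r = 0 → f r = 0) : ∃ f' : S →+ G, ∀ r, f' (π r) = f r := by
  have hw : ∀ r r', π r = π r' → f r = f r' := by
    intro r r' e
    rw [← sub_eq_zero, ← map_sub] at e ⊢
    exact h _ e
  let g : S → G := fun s => f (Function.surjInv hπ s)
  have hf : ∀ r, g (π r) = f r := fun r => hw _ _ (Function.surjInv_eq _ _)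
  refine ⟨AddMonoidHom.mk' g ?_, hf⟩
  intro s t
  obtain ⟨s, rfl⟩ := hπ s
  obtain ⟨t, rfl⟩ := hπ t
  rw [← map_add, hf, hf, hf, map_add]

lemma exists_quot.{ur, uf} {R : Type ur} {F : Type uf} [CommRing R] [CommRing F] (I : Ideal R)
    (q0 : R →+* F) (hq0 : ∀ r ∈ I, q0 r = 0) :
    ∃ (S : Type ur) (_ : CommRing S) (π : R →+* S) (q : S →+* F), Function.Surjective π ∧
      (∀ r, π r = 0 ↔ r ∈ I) ∧ ∀ r, q (π r) = q0 r :=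
  ⟨R ⧸ I, inferInstance, Ideal.Quotient.mk I, Ideal.Quotient.lift I q0 hq0,
    Ideal.Quotient.mk_surjective, fun _ => Ideal.Quotient.eq_zero_iff_mem, fun _ => rfl⟩

open MvPolynomial in
open scoped Classical in
lemma exists_model.{uw, uf} {F : Type uf} {W : Type uw} [Field F] [CommRing W] (ε : W →+* F) (M : ℕ)
    (hM0 : 0 < M) (hM : (M : W) = 0) (b1 b2 : F) (w1 w2 : W) (h1 : ε w1 = b1 ^ M)
    (h2 : ε w2 = b2 ^ M) :
    ∃ (S : Type uw) (_ : CommRing S), Nonempty (Model (S := S) ε M b1 b2 w1 w2) := by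
  let p1 : (MvPolynomial (Fin 2) W) := X 0 ^ M - C w1
  let p2 : (MvPolynomial (Fin 2) W) := X 1 ^ M - C w2
  let I : Ideal (MvPolynomial (Fin 2) W) := Ideal.span {p1, p2}
  let D : Fin 2 → Derivation ℤ (MvPolynomial (Fin 2) W) (MvPolynomial (Fin 2) W) := fun i =>
    ((X i : (MvPolynomial (Fin 2) W)) • (pderiv i : Derivation W (MvPolynomial (Fin 2) W) (MvPolynomial (Fin 2) W))).restrictScalars ℤ
  have hD : ∀ i e (w : W), D i (monomial e w) = monomial e ((e i : W) * w) := by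
    intro i e w
    change X i * pderiv i (monomial e w) = _
    rw [X_mul_pderiv_monomial, ← map_nsmul, nsmul_eq_mul]
  have hDC : ∀ i w, D i (C w) = 0 := by
    intro i w
    rw [← monomial_zero', hD]; simp
  have hDX : ∀ i j, D i (X j) = if j = i then X j else 0 := by
    intro i j
    rw [X, hD]
    by_cases h : j = i
    · simp [h]
    · simp [h]
  have hMR : ((M : ℕ) : (MvPolynomial (Fin 2) W)) = 0 := by
    rw [← map_natCast (C : W →+* (MvPolynomial (Fin 2) W)), hM, map_zero]
  have hDp : ∀ i j (w : W), D i (X j ^ M - C w) = 0 := by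
    intro i j w
    rw [map_sub, hDC, Derivation.leibniz_pow, nsmul_eq_mul, hMR]; simp
  have hp1 : p1 ∈ I := Ideal.subset_span (by simp)
  have hp2 : p2 ∈ I := Ideal.subset_span (by simp)
  have hDI : ∀ i, ∀ r ∈ I, D i r ∈ I := by
    intro i r hr
    obtain ⟨a, b, rfl⟩ := Ideal.mem_span_pair.1 hr
    rw [map_add, Derivation.leibniz, Derivation.leibniz, hDp, hDp]
    simp only [smul_eq_mul, mul_zero, zero_add]
    exact add_mem (I.mul_mem_right _ hp1) (I.mul_mem_right _ hp2)
  let τ : (Fin 2 →₀ ℕ) → W := fun e =>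
    if M ∣ e 0 ∧ M ∣ e 1 then w1 ^ (e 0 / M) * w2 ^ (e 1 / M) else 0
  let ρ : (MvPolynomial (Fin 2) W) →ₗ[W] W := (basisMonomials (Fin 2) W).constr W τ
  have hρ : ∀ e w, ρ (monomial e w) = w * τ e := by
    intro e w
    have : (monomial e w : (MvPolynomial (Fin 2) W)) = w • (basisMonomials (Fin 2) W e) := by
      rw [coe_basisMonomials, smul_monomial]; simp
    rw [this, map_smul, Module.Basis.constr_basis, smul_eq_mul]
  have hmon : ∀ {P : (MvPolynomial (Fin 2) W) → Prop}, (∀ e w, P (monomial e w)) → (∀ a b, P a → P b → P (a + b)) →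
      ∀ r, P r := by
    intro P h1 h2 r
    exact MvPolynomial.induction_on' r h1 (fun a b => h2 a b)
  have hρ1 : ∀ a, ρ (a * p1) = 0 := by
    refine hmon ?_ ?_
    · intro e w
      have e1 : (monomial e w : (MvPolynomial (Fin 2) W)) * p1 = monomial (e + Finsupp.single 0 M) w -
          monomial e (w * w1) := by
        rw [mul_sub, X_pow_eq_monomial, monomial_mul, mul_one, mul_comm, C_mul_monomial, mul_comm w]
      rw [e1, map_sub, hρ, hρ]
      have : τ (e + Finsupp.single 0 M) = w1 * τ e := by
        simp only [τ, Finsupp.add_apply, Finsupp.single_eq_same, Nat.dvd_add_self_right]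
        rw [Finsupp.single_eq_of_ne (by decide), add_zero, Nat.add_div_right _ hM0]
        split_ifs <;> ring
      rw [this]; ring
    · intro a b ha hb
      rw [add_mul, map_add, ha, hb, add_zero]
  have hρ2 : ∀ a, ρ (a * p2) = 0 := by
    refine hmon ?_ ?_
    · intro e w
      have e1 : (monomial e w : (MvPolynomial (Fin 2) W)) * p2 = monomial (e + Finsupp.single 1 M) w -
          monomial e (w * w2) := by
        rw [mul_sub, X_pow_eq_monomial, monomial_mul, mul_one, mul_comm, C_mul_monomial, mul_comm w]
      rw [e1, map_sub, hρ, hρ]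
      have : τ (e + Finsupp.single 1 M) = w2 * τ e := by
        simp only [τ, Finsupp.add_apply, Finsupp.single_eq_same, Nat.dvd_add_self_right]
        rw [Finsupp.single_eq_of_ne (by decide), add_zero, Nat.add_div_right _ hM0]
        split_ifs <;> ring
      rw [this]; ring
    · intro a b ha hb
      rw [add_mul, map_add, ha, hb, add_zero]
  have hρI : ∀ r ∈ I, ρ r = 0 := by
    intro r hr
    obtain ⟨a, b, rfl⟩ := Ideal.mem_span_pair.1 hr
    rw [map_add, hρ1, hρ2, add_zero]
  have hcast : ∀ n, M ∣ n → (n : W) = 0 := by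
    rintro _ ⟨k, rfl⟩
    rw [Nat.cast_mul, hM, zero_mul]
  have hρD : ∀ i r, ρ (D i r) = 0 := by
    intro i
    refine hmon ?_ ?_
    · intro e w
      rw [hD, hρ]
      by_cases h : M ∣ e 0 ∧ M ∣ e 1
      · have : M ∣ e i := by fin_cases i; exacts [h.1, h.2]
        rw [hcast _ this]; ring
      · simp only [τ, if_neg h, mul_zero]
    · intro a b ha hb
      rw [map_add, map_add, ha, hb, add_zero]
  let q0 : (MvPolynomial (Fin 2) W) →+* F := eval₂Hom ε ![b1, b2]
  have hqX0 : q0 (X 0) = b1 := by simp only [q0, eval₂Hom_X']; rfl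
  have hqX1 : q0 (X 1) = b2 := by simp only [q0, eval₂Hom_X']; rfl
  have hqC : ∀ w, q0 (C w) = ε w := fun w => by simp only [q0, eval₂Hom_C]
  have hq0 : ∀ r ∈ I, q0 r = 0 := by
    intro r hr
    obtain ⟨a, b, rfl⟩ := Ideal.mem_span_pair.1 hr
    rw [map_add, map_mul, map_mul, map_sub, map_sub, map_pow, map_pow, hqX0, hqX1, hqC, hqC, h1, h2]
    ring
  obtain ⟨S, _, π, q, hπ, hker, hq⟩ := exists_quot I q0 hq0
  obtain ⟨D1, hD1⟩ := exists_der_quot π hπ (D 0) (fun r hr => (hker _).2 (hDI 0 r ((hker r).1 hr)))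
  obtain ⟨D2, hD2⟩ := exists_der_quot π hπ (D 1) (fun r hr => (hker _).2 (hDI 1 r ((hker r).1 hr)))
  obtain ⟨ρ', hρ'⟩ := exists_hom_quot π hπ ρ.toAddMonoidHom (fun r hr => hρI r ((hker r).1 hr))
  refine ⟨S, inferInstance, ⟨⟨π.comp C, π (X 0), π (X 1), D1, D2, ρ', q,
    ?_, ?_, ?_, ?_, ?_, ?_, ?_, ?_, ?_, ?_, ?_, ?_, ?_, ?_, ?_, ?_⟩⟩⟩
  · intro s
    obtain ⟨s, rfl⟩ := hπ s
    revert s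
    refine hmon ?_ ?_
    · intro e w
      refine AddSubmonoid.subset_closure ⟨w, e 0, e 1, ?_⟩
      rw [RingHom.comp_apply, ← map_pow, ← map_pow, ← map_mul, ← map_mul, monomial_eq,
        Finsupp.prod_fintype _ _ (by simp), Fin.prod_univ_two, mul_assoc]
    · intro a b ha hb
      rw [map_add]; exact add_mem ha hb
  · rw [← map_pow, RingHom.comp_apply]
    exact sub_eq_zero.1 (by rw [← map_sub]; exact (hker _).2 hp1)
  · rw [← map_pow, RingHom.comp_apply]
    exact sub_eq_zero.1 (by rw [← map_sub]; exact (hker _).2 hp2)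
  · intro w
    exact (hD1 _).trans ((congrArg π (hDC 0 w)).trans (map_zero π))
  · intro w
    exact (hD2 _).trans ((congrArg π (hDC 1 w)).trans (map_zero π))
  · exact (hD1 _).trans (congrArg π ((hDX 0 0).trans (if_pos rfl)))
  · exact (hD1 _).trans ((congrArg π ((hDX 0 1).trans (if_neg (by decide)))).trans (map_zero π))
  · exact (hD2 _).trans ((congrArg π ((hDX 1 0).trans (if_neg (by decide)))).trans (map_zero π))
  · exact (hD2 _).trans (congrArg π ((hDX 1 1).trans (if_pos rfl)))
  · intro s
    obtain ⟨s, rfl⟩ := hπ s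
    rw [hD1, hρ']; exact hρD 0 s
  · intro s
    obtain ⟨s, rfl⟩ := hπ s
    rw [hD2, hρ']; exact hρD 1 s
  · rw [← map_one π, hρ']
    change ρ 1 = 1
    rw [show (1 : (MvPolynomial (Fin 2) W)) = monomial 0 1 from rfl, hρ]
    simp [τ]
  · intro w s
    obtain ⟨s, rfl⟩ := hπ s
    rw [RingHom.comp_apply, ← map_mul, hρ', hρ']
    change ρ (C w * s) = w * ρ s
    rw [C_mul', map_smul, smul_eq_mul]
  · intro w
    rw [RingHom.comp_apply, hq, hqC]
  · rw [hq, hqX0]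
  · rw [hq, hqX1]

end Model

end Milnor

namespace Milnor

section ModelLemmas

variable {F W S : Type*} [Field F] [CharP F 2] [CommRing W] [CommRing S] {ε : W →+* F} {M m : ℕ}
  {b1 b2 : F} {w1 w2 : W} (X : Model (S := S) ε M b1 b2 w1 w2)

/-- hypotheses on the coefficient ring -/
structure Coef (ε : W →+* F) (m : ℕ) : Prop where
  two : (2 : W) ^ (m + 1) = 0
  mm : ∀ x y : W, ε x = 0 → ε y = 0 → ∃ z, ε z = 0 ∧ x * y = 2 * z

lemma q_two {R : Type*} [CommRing R] (q : R →+* F) : q 2 = 0 := by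
  rw [map_ofNat]; exact CharTwo.two_eq_zero

lemma Coef.pow {ε : W →+* F} (h : Coef ε m) {c : W} (hc : ε c = 0) (n : ℕ) :
    ∃ g, ε g = 0 ∧ c ^ (n + 1) = 2 ^ n * g := by
  induction n with
  | zero => exact ⟨c, hc, by ring⟩
  | succ n ih =>
    obtain ⟨g, hg, e⟩ := ih
    obtain ⟨z, hz, e'⟩ := h.mm g c hg hc
    exact ⟨z, hz, by rw [pow_succ, e, pow_succ, mul_assoc, e']; ring⟩

lemma Coef.nat {ε : W →+* F} (h : Coef ε m) (n : ℕ) :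
    ∃ t : W, ((n + 1 : ℕ) : W) * t = 2 ^ n := by
  obtain ⟨a, o, ho, e⟩ := Nat.exists_eq_two_pow_mul_odd (Nat.succ_ne_zero n)
  have ha : a ≤ n := by
    have h1 : a < 2 ^ a := Nat.lt_two_pow_self
    have h2 : 2 ^ a ≤ n + 1 := by
      rw [← Nat.succ_eq_add_one, e]; exact Nat.le_mul_of_pos_right _ ho.pos
    omega
  have hu : IsUnit ((o : ℕ) : W) := by
    obtain ⟨k, rfl⟩ := ho
    have : IsNilpotent ((2 * k : ℕ) : W) := ⟨m + 1, by
      push_cast; rw [mul_pow, h.two, zero_mul]⟩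
    rw [Nat.cast_add, Nat.cast_one]
    exact this.isUnit_add_one
  obtain ⟨o', ho'⟩ := hu.exists_right_inv
  refine ⟨o' * 2 ^ (n - a), ?_⟩
  rw [← Nat.succ_eq_add_one, e]
  push_cast
  calc (2 : W) ^ a * o * (o' * 2 ^ (n - a)) = (o * o') * (2 ^ a * 2 ^ (n - a)) := by ring
    _ = 2 ^ n := by rw [ho', ← pow_add, one_mul]; congr 1; omega

lemma Model.ind {P : S → Prop} (h : ∀ w i j, P (X.κ w * X.x ^ i * X.y ^ j)) (h0 : P 0)
    (hadd : ∀ a b, P a → P b → P (a + b)) (s : S) : P s := by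
  refine AddSubmonoid.closure_induction (motive := fun s _ => P s) ?_ h0
    (fun a b _ _ ha hb => hadd a b ha hb) (X.gen s)
  rintro _ ⟨w, i, j, rfl⟩
  exact h w i j

lemma derS_mul {S : Type*} [CommRing S] (D : Derivation ℤ S S) (a b : S) :
    D (a * b) = a * D b + D a * b := by
  rw [D.leibniz, smul_eq_mul, smul_eq_mul]; ring

lemma derS_pow {S : Type*} [CommRing S] (D : Derivation ℤ S S) {x c : S} (h : D x = c * x) (n : ℕ) :
    D (x ^ n) = n * c * x ^ n := by
  induction n with
  | zero => simp
  | succ n ih => rw [pow_succ, derS_mul, ih, h]; push_cast; ring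

lemma Model.D1mon (w : W) (i j : ℕ) : X.D1 (X.κ w * X.x ^ i * X.y ^ j) =
    i * (X.κ w * X.x ^ i * X.y ^ j) := by
  rw [derS_mul, derS_mul, X.D1κ, derS_pow X.D1 (x := X.x) (c := 1) (by rw [X.D1x, one_mul]),
    derS_pow X.D1 (x := X.y) (c := 0) (by rw [X.D1y, zero_mul])]
  ring

lemma Model.D2mon (w : W) (i j : ℕ) : X.D2 (X.κ w * X.x ^ i * X.y ^ j) =
    j * (X.κ w * X.x ^ i * X.y ^ j) := by
  rw [derS_mul, derS_mul, X.D2κ, derS_pow X.D2 (x := X.x) (c := 0) (by rw [X.D2x, zero_mul]),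
    derS_pow X.D2 (x := X.y) (c := 1) (by rw [X.D2y, one_mul])]
  ring

lemma Model.comm (s : S) : X.D1 (X.D2 s) = X.D2 (X.D1 s) := by
  induction s using X.ind with
  | h w i j =>
    rw [X.D2mon, X.D1mon, derS_mul X.D1 (j : S), derS_mul X.D2 (i : S), X.D1mon, X.D2mon,
      Derivation.map_natCast, Derivation.map_natCast]; ring
  | h0 => simp only [map_zero]
  | hadd a b ha hb => simp only [map_add, ha, hb]

lemma Model.qD1 {E : Derivation ℤ F F} (h0 : ∀ w, E (ε w) = 0) (h1 : E b1 = b1) (h2 : E b2 = 0)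
    (s : S) : X.q (X.D1 s) = E (X.q s) := by
  induction s using X.ind with
  | h w i j =>
    rw [X.D1mon]
    simp only [map_mul, map_pow, map_natCast, X.qκ, X.qx, X.qy]
    rw [derS_mul, derS_mul, h0, derS_pow E (x := b1) (c := 1) (by rw [h1, one_mul]),
      derS_pow E (x := b2) (c := 0) (by rw [h2, zero_mul])]
    ring
  | h0 => simp only [map_zero]
  | hadd a b ha hb => simp only [map_add, ha, hb]

lemma Model.qD2 {E : Derivation ℤ F F} (h0 : ∀ w, E (ε w) = 0) (h1 : E b1 = 0) (h2 : E b2 = b2)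
    (s : S) : X.q (X.D2 s) = E (X.q s) := by
  induction s using X.ind with
  | h w i j =>
    rw [X.D2mon]
    simp only [map_mul, map_pow, map_natCast, X.qκ, X.qx, X.qy]
    rw [derS_mul, derS_mul, h0, derS_pow E (x := b1) (c := 0) (by rw [h1, zero_mul]),
      derS_pow E (x := b2) (c := 1) (by rw [h2, one_mul])]
    ring
  | h0 => simp only [map_zero]
  | hadd a b ha hb => simp only [map_add, ha, hb]

/-- generating set of the kernel -/
def Model.J : AddSubmonoid S :=
  AddSubmonoid.closure {s : S | ∃ w i j, ε w = 0 ∧ s = X.κ w * X.x ^ i * X.y ^ j}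

/-- independence hypothesis -/
def UniqW (ε : W →+* F) (M : ℕ) (b1 b2 : F) : Prop := ∀ c : ℕ → ℕ → W,
  ∑ i ∈ Finset.range M, ∑ j ∈ Finset.range M, ε (c i j) * b1 ^ i * b2 ^ j = 0 →
  ∀ i < M, ∀ j < M, ε (c i j) = 0

lemma Model.box (hM : 0 < M) (s : S) : ∃ c : ℕ → ℕ → W,
    s = ∑ i ∈ Finset.range M, ∑ j ∈ Finset.range M, X.κ (c i j) * X.x ^ i * X.y ^ j := by
  induction s using X.ind with
  | h w i j =>
    refine ⟨fun i' j' => if i' = i % M then (if j' = j % M then w * w1 ^ (i / M) * w2 ^ (j / M)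
      else 0) else 0, ?_⟩
    rw [Finset.sum_eq_single (i % M), Finset.sum_eq_single (j % M)]
    · beta_reduce
      rw [if_pos rfl, if_pos rfl, map_mul, map_mul, map_pow, map_pow, ← X.hx, ← X.hy]
      conv_lhs => rw [← Nat.div_add_mod i M, ← Nat.div_add_mod j M, pow_add, pow_add, pow_mul, pow_mul]
      ring
    · intro j' _ hj'
      beta_reduce
      rw [if_pos rfl, if_neg hj', map_zero, zero_mul, zero_mul]
    · intro h; exact absurd (Finset.mem_range.2 (Nat.mod_lt _ hM)) h
    · intro i' _ hi'
      refine Finset.sum_eq_zero fun j' _ => ?_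
      beta_reduce
      rw [if_neg hi', map_zero, zero_mul, zero_mul]
    · intro h; exact absurd (Finset.mem_range.2 (Nat.mod_lt _ hM)) h
  | h0 => exact ⟨fun _ _ => 0, by simp⟩
  | hadd a b ha hb =>
    obtain ⟨c, hc⟩ := ha
    obtain ⟨d, hd⟩ := hb
    refine ⟨fun i j => c i j + d i j, ?_⟩
    rw [hc, hd, ← Finset.sum_add_distrib]
    refine Finset.sum_congr rfl fun i _ => ?_
    rw [← Finset.sum_add_distrib]
    refine Finset.sum_congr rfl fun j _ => ?_
    rw [map_add]; ring

lemma Model.mem_J (hM : 0 < M) (hu : UniqW ε M b1 b2) {s : S} (hs : X.q s = 0) : s ∈ X.J := by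
  obtain ⟨c, rfl⟩ := X.box hM s
  simp only [map_sum, map_mul, map_pow, X.qκ, X.qx, X.qy] at hs
  have h := hu c hs
  refine sum_mem fun i hi => sum_mem fun j hj => AddSubmonoid.subset_closure ⟨c i j, i, j, ?_, rfl⟩
  exact h i (Finset.mem_range.1 hi) j (Finset.mem_range.1 hj)

lemma Model.J_ind {P : S → Prop} (h : ∀ w i j, ε w = 0 → P (X.κ w * X.x ^ i * X.y ^ j)) (h0 : P 0)
    (hadd : ∀ a b, a ∈ X.J → b ∈ X.J → P a → P b → P (a + b)) {s : S} (hs : s ∈ X.J) : P s := by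
  refine AddSubmonoid.closure_induction (motive := fun s _ => P s) ?_ h0
    (fun a b h1 h2 ha hb => hadd a b h1 h2 ha hb) hs
  rintro _ ⟨w, i, j, hw, rfl⟩
  exact h w i j hw

lemma Model.q_J {s : S} (hs : s ∈ X.J) : X.q s = 0 := by
  refine X.J_ind (P := fun s => X.q s = 0) ?_ (map_zero _) ?_ hs
  · intro w i j hw
    simp only [map_mul, X.qκ, hw, zero_mul]
  · intro a b _ _ ha hb
    rw [map_add, ha, hb, add_zero]

lemma Model.ρ_J {s : S} (hs : s ∈ X.J) : ε (X.ρ s) = 0 := by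
  refine X.J_ind (P := fun s => ε (X.ρ s) = 0) ?_ (by simp) ?_ hs
  · intro w i j hw
    rw [mul_assoc, X.ρκ, map_mul, hw, zero_mul]
  · intro a b _ _ ha hb
    rw [map_add, map_add, ha, hb, add_zero]

lemma Model.JJ (hW : Coef ε m) {s t : S} (hs : s ∈ X.J) (ht : t ∈ X.J) :
    ∃ z ∈ X.J, s * t = 2 * z := by
  refine X.J_ind (P := fun s => ∃ z ∈ X.J, s * t = 2 * z) ?_ ⟨0, zero_mem _, by simp⟩ ?_ hs
  · intro w i j hw
    refine X.J_ind (P := fun t => ∃ z ∈ X.J, X.κ w * X.x ^ i * X.y ^ j * t = 2 * z) ?_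
      ⟨0, zero_mem _, by simp⟩ ?_ ht
    · intro w' i' j' hw'
      obtain ⟨z, hz, e⟩ := hW.mm w w' hw hw'
      refine ⟨X.κ z * X.x ^ (i + i') * X.y ^ (j + j'),
        AddSubmonoid.subset_closure ⟨z, _, _, hz, rfl⟩, ?_⟩
      have e' := congrArg X.κ e
      rw [map_mul, map_mul, map_ofNat] at e'
      rw [pow_add, pow_add]
      linear_combination (X.x ^ i * X.x ^ i' * X.y ^ j * X.y ^ j') * e'
    · rintro a b _ _ ⟨z, hz, e⟩ ⟨z', hz', e'⟩
      exact ⟨z + z', add_mem hz hz', by linear_combination e + e'⟩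
  · rintro a b _ _ ⟨z, hz, e⟩ ⟨z', hz', e'⟩
    exact ⟨z + z', add_mem hz hz', by linear_combination e + e'⟩

lemma Model.two (X : Model (S := S) ε M b1 b2 w1 w2) (hW : Coef ε m) : (2 : S) ^ (m + 1) = 0 := by
  have := congrArg X.κ hW.two
  rwa [map_pow, map_ofNat, map_zero] at this

lemma Model.J_pow (hW : Coef ε m) {s : S} (hs : s ∈ X.J) (n : ℕ) :
    ∃ z ∈ X.J, s ^ (n + 1) = 2 ^ n * z := by
  induction n with
  | zero => exact ⟨s, hs, by ring⟩
  | succ n ih =>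
    obtain ⟨g, hg, e⟩ := ih
    obtain ⟨z, hz, e'⟩ := X.JJ hW hg hs
    exact ⟨z, hz, by rw [pow_succ, e, pow_succ, mul_assoc, e']; ring⟩

lemma Model.J_nil (hW : Coef ε m) {s : S} (hs : s ∈ X.J) : s ^ (m + 1 + 1) = 0 := by
  obtain ⟨z, _, e⟩ := X.J_pow hW hs (m + 1)
  rw [e, X.two hW, zero_mul]

lemma Model.unit (hM : 0 < M) (hu : UniqW ε M b1 b2) (hq : Function.Surjective X.q)
    (hW : Coef ε m) {s : S} (hs : X.q s ≠ 0) : IsUnit s := by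
  obtain ⟨t, ht⟩ := hq (X.q s)⁻¹
  have h1 : s * t - 1 ∈ X.J := X.mem_J hM hu (by
    rw [map_sub, map_mul, ht, map_one, mul_inv_cancel₀ hs, sub_self])
  have h2 : IsNilpotent (s * t - 1) := ⟨_, X.J_nil hW h1⟩
  have h3 := h2.isUnit_one_add
  rw [add_sub_cancel] at h3
  exact isUnit_of_mul_isUnit_left h3

/-- logarithms exist -/
def Model.Good (u : S) : Prop := ∃ l, X.D1 l * u = X.D1 u ∧ X.D2 l * u = X.D2 u

lemma Model.Good.mul {X : Model (S := S) ε M b1 b2 w1 w2} {u v : S} (hu : X.Good u) (hv : X.Good v) :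
    X.Good (u * v) := by
  obtain ⟨l, h1, h2⟩ := hu
  obtain ⟨l', h1', h2'⟩ := hv
  refine ⟨l + l', ?_, ?_⟩
  · rw [map_add, derS_mul]; linear_combination v * h1 + u * h1'
  · rw [map_add, derS_mul]; linear_combination v * h2 + u * h2'

lemma geom_aux {S : Type*} [CommRing S] (z : S) (n : ℕ) :
    (∑ k ∈ Finset.range n, (-1) ^ k * z ^ (k + 1)) * (1 + z) = z - (-1) ^ n * z ^ (n + 1) := by
  induction n with
  | zero => simp
  | succ n ih => rw [Finset.sum_range_succ, add_mul, ih]; ring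

lemma Model.good_gen (hW : Coef ε m) {c : W} (hc : ε c = 0) (i j : ℕ) :
    X.Good (1 + X.κ c * X.x ^ i * X.y ^ j) := by
  choose g hg hg' using hW.pow hc
  choose t ht using hW.nat
  set z := X.κ c * X.x ^ i * X.y ^ j with hz
  have hzJ : z ∈ X.J := AddSubmonoid.subset_closure ⟨c, i, j, hc, rfl⟩
  have hz0 := X.J_nil hW hzJ
  have hterm : ∀ k, ((k + 1 : ℕ) : S) * X.κ ((-1) ^ k * t k * g k) * X.x ^ (i * (k + 1)) *
      X.y ^ (j * (k + 1)) = (-1) ^ k * z ^ (k + 1) := by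
    intro k
    have e : X.κ (((k + 1 : ℕ) : W) * t k * g k) = X.κ (c ^ (k + 1)) := by rw [ht, hg']
    simp only [map_mul, map_natCast, map_pow] at e
    simp only [map_mul, map_pow, map_neg, map_one, hz, mul_pow, ← pow_mul]
    linear_combination ((-1) ^ k * X.x ^ (i * (k + 1)) * X.y ^ (j * (k + 1))) * e
  refine ⟨∑ k ∈ Finset.range (m + 1),
    X.κ ((-1) ^ k * t k * g k) * X.x ^ (i * (k + 1)) * X.y ^ (j * (k + 1)), ?_, ?_⟩
  · rw [map_add, Derivation.map_one_eq_zero, zero_add, hz, X.D1mon, ← hz]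
    have : X.D1 (∑ k ∈ Finset.range (m + 1),
        X.κ ((-1) ^ k * t k * g k) * X.x ^ (i * (k + 1)) * X.y ^ (j * (k + 1))) =
        i * ∑ k ∈ Finset.range (m + 1), (-1) ^ k * z ^ (k + 1) := by
      rw [map_sum, Finset.mul_sum]
      refine Finset.sum_congr rfl fun k _ => ?_
      rw [X.D1mon, ← hterm]; push_cast; ring
    rw [this, mul_assoc, geom_aux, hz0, mul_zero, sub_zero]
  · rw [map_add, Derivation.map_one_eq_zero, zero_add, hz, X.D2mon, ← hz]
    have : X.D2 (∑ k ∈ Finset.range (m + 1),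
        X.κ ((-1) ^ k * t k * g k) * X.x ^ (i * (k + 1)) * X.y ^ (j * (k + 1))) =
        j * ∑ k ∈ Finset.range (m + 1), (-1) ^ k * z ^ (k + 1) := by
      rw [map_sum, Finset.mul_sum]
      refine Finset.sum_congr rfl fun k _ => ?_
      rw [X.D2mon, ← hterm]; push_cast; ring
    rw [this, mul_assoc, geom_aux, hz0, mul_zero, sub_zero]

lemma Model.good_one : X.Good 1 := ⟨0, by simp, by simp⟩

lemma Model.good_aux (hM : 0 < M) (hu : UniqW ε M b1 b2) (hq : Function.Surjective X.q)
    (hW : Coef ε m) (d : ℕ) : ∀ s, s + d = m + 1 → ∀ a ∈ X.J, X.Good (1 + 2 ^ s * a) := by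
  induction d with
  | zero =>
    intro s hs a _
    obtain rfl : s = m + 1 := by omega
    rw [X.two hW, zero_mul, add_zero]; exact X.good_one
  | succ d ih =>
    intro s hs a ha
    refine X.J_ind (P := fun a => X.Good (1 + 2 ^ s * a)) ?_ ?_ ?_ ha
    · intro w i j hw
      have := X.good_gen hW (c := 2 ^ s * w) (by rw [map_mul, hw, mul_zero]) i j
      rw [map_mul, map_pow, map_ofNat] at this
      convert this using 2
      ring
    · rw [mul_zero, add_zero]; exact X.good_one
    · intro a b hja hjb ha hb
      obtain ⟨z, hz, e⟩ := X.JJ hW hja hjb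
      have hP : X.q ((1 + 2 ^ s * a) * (1 + 2 ^ s * b)) = 1 := by
        simp only [map_mul, map_add, map_one, X.q_J hja, X.q_J hjb, mul_zero, add_zero, mul_one]
      obtain ⟨p, hp⟩ := (X.unit hM hu hq hW (by rw [hP]; exact one_ne_zero)).exists_right_inv
      have hz' : X.q (-(2 ^ s * z * p)) = 0 := by
        simp only [map_mul, map_neg, X.q_J hz, mul_zero, zero_mul, neg_zero]
      have h3 := ih (s + 1) (by omega) _ (X.mem_J hM hu hz')
      have h4 := (ha.mul hb).mul h3
      convert h4 using 1
      linear_combination (-(2 : S) ^ s * 2 ^ s) * e + 2 ^ (s + 1) * 2 ^ s * z * hp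

lemma Model.good (hM : 0 < M) (hu : UniqW ε M b1 b2) (hq : Function.Surjective X.q)
    (hW : Coef ε m) {s : S} (hs : X.q s = 1) : X.Good s := by
  have := X.good_aux hM hu hq hW (m + 1) 0 (by omega) (s - 1) (X.mem_J hM hu (by
    rw [map_sub, hs, map_one, sub_self]))
  rwa [pow_zero, one_mul, add_sub_cancel] at this

end ModelLemmas

end Milnor

namespace Milnor

section Lambda

/-- logarithmic derivative -/
def th {S : Type*} [CommRing S] (D : Derivation ℤ S S) (s : Sˣ) : S := D s * (s⁻¹ : Sˣ)

lemma th_mul {S : Type*} [CommRing S] (D : Derivation ℤ S S) (s t : Sˣ) :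
    th D (s * t) = th D s + th D t := by
  have e1 : (s : S) * (s⁻¹ : Sˣ) = 1 := s.mul_inv
  have e2 : (t : S) * (t⁻¹ : Sˣ) = 1 := t.mul_inv
  rw [th, th, th, mul_inv, Units.val_mul, Units.val_mul, derS_mul]
  linear_combination (D t * (t⁻¹ : Sˣ)) * e1 + (D s * (s⁻¹ : Sˣ)) * e2

lemma th_spec {S : Type*} [CommRing S] (D : Derivation ℤ S S) (s : Sˣ) :
    th D s * s = D s := by
  rw [th, mul_assoc, Units.inv_mul, mul_one]

/-- the symbol on lifts -/
def ww {S : Type*} [CommRing S] (D D' : Derivation ℤ S S) (s t : Sˣ) : S :=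
  th D s * th D' t - th D' s * th D t

variable {F W S : Type*} [Field F] [CharP F 2] [CommRing W] [CommRing S] {ε : W →+* F} {M m : ℕ}
  {b1 b2 : F} {w1 w2 : W} (X : Model (S := S) ε M b1 b2 w1 w2)

lemma Model.ww_kill (hM : 0 < M) (hu : UniqW ε M b1 b2) (hq : Function.Surjective X.q)
    (hW : Coef ε m) {s : Sˣ} (hs : X.q s = 1) (t : Sˣ) : X.ρ (ww X.D1 X.D2 s t) = 0 := by
  obtain ⟨l, h1, h2⟩ := X.good hM hu hq hW hs
  have e1 : th X.D1 s = X.D1 l := by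
    rw [th, ← h1, mul_assoc, Units.mul_inv, mul_one]
  have e2 : th X.D2 s = X.D2 l := by
    rw [th, ← h2, mul_assoc, Units.mul_inv, mul_one]
  have hc : X.D1 (th X.D2 t) = X.D2 (th X.D1 t) := by
    have g1 := congrArg X.D1 (th_spec X.D2 t)
    have g2 := congrArg X.D2 (th_spec X.D1 t)
    rw [derS_mul] at g1 g2
    have g3 := X.comm (t : S)
    have g4 : X.D1 (th X.D2 t) * t = X.D2 (th X.D1 t) * t := by
      linear_combination g1 - g2 + g3 + th X.D2 t * th_spec X.D1 t - th X.D1 t * th_spec X.D2 t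
    exact t.mul_left_inj.1 g4
  have key : ww X.D1 X.D2 s t = X.D1 (l * th X.D2 t) - X.D2 (l * th X.D1 t) := by
    rw [ww, e1, e2, derS_mul, derS_mul]
    linear_combination (-l) * hc
  rw [key, map_sub, X.ρD1, X.ρD2, sub_zero]

lemma ww_mul_left {S : Type*} [CommRing S] (D D' : Derivation ℤ S S) (s s' t : Sˣ) :
    ww D D' (s * s') t = ww D D' s t + ww D D' s' t := by
  simp only [ww, th_mul]; ring

lemma ww_swap {S : Type*} [CommRing S] (D D' : Derivation ℤ S S) (s t : Sˣ) :
    ww D D' s t = - ww D D' t s := by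
  simp only [ww]; ring

lemma Model.ww_left (hM : 0 < M) (hu : UniqW ε M b1 b2) (hq : Function.Surjective X.q)
    (hW : Coef ε m) {s s' : Sˣ} (hs : X.q s = X.q s') (t : Sˣ) :
    X.ρ (ww X.D1 X.D2 s t) = X.ρ (ww X.D1 X.D2 s' t) := by
  have h1 : X.q ((s * s'⁻¹ : Sˣ) : S) = 1 := by
    rw [Units.val_mul, map_mul, hs, ← map_mul, Units.mul_inv, map_one]
  have h2 := X.ww_kill hM hu hq hW h1 t
  have h3 : ww X.D1 X.D2 s t = ww X.D1 X.D2 (s * s'⁻¹) t + ww X.D1 X.D2 s' t := by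
    rw [← ww_mul_left, inv_mul_cancel_right]
  rw [h3, map_add, h2, zero_add]

lemma Model.ww_right (hM : 0 < M) (hu : UniqW ε M b1 b2) (hq : Function.Surjective X.q)
    (hW : Coef ε m) {t t' : Sˣ} (ht : X.q t = X.q t') (s : Sˣ) :
    X.ρ (ww X.D1 X.D2 s t) = X.ρ (ww X.D1 X.D2 s t') := by
  rw [ww_swap, ww_swap _ _ s t', map_neg, map_neg, X.ww_left hM hu hq hW ht]

lemma Model.exists_lambda (hM : 0 < M) (hu : UniqW ε M b1 b2) (hq : Function.Surjective X.q)
    (hW : Coef ε m) {E1 E2 : Derivation ℤ F F} (hE1 : ∀ s, X.q (X.D1 s) = E1 (X.q s))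
    (hE2 : ∀ s, X.q (X.D2 s) = E2 (X.q s)) :
    ∃ φ : K F 2 →+ W, ∀ T, ∃ s, φ T = X.ρ s ∧ X.q s = om E1 E2 T := by
  have hlift : ∀ a : Fˣ, ∃ s : Sˣ, X.q s = a := by
    intro a
    obtain ⟨s, hs⟩ := hq a
    obtain ⟨u, rfl⟩ := X.unit hM hu hq hW (s := s) (by rw [hs]; exact a.ne_zero)
    exact ⟨u, hs⟩
  choose σ hσ using hlift
  have hr : ∀ a b b', X.ρ (ww X.D1 X.D2 (σ (a * b)) b') =
      X.ρ (ww X.D1 X.D2 (σ a) b') + X.ρ (ww X.D1 X.D2 (σ b) b') := by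
    intro a b b'
    rw [← map_add, ← ww_mul_left]
    exact X.ww_left hM hu hq hW (by rw [Units.val_mul, map_mul, hσ, hσ, hσ, Units.val_mul]) _
  obtain ⟨φ, hφ⟩ := exists_lift (fun a b => X.ρ (ww X.D1 X.D2 (σ a) (σ b)))
    (fun a a' b => hr a a' (σ b))
    (fun a b b' => by
      beta_reduce
      rw [ww_swap, map_neg, hr, ww_swap _ _ (σ a) (σ b), ww_swap _ _ (σ a) (σ b'), map_neg, map_neg]
      abel)
    (fun a b hab => by
      beta_reduce
      have hb : X.q (1 - (σ a : S)) = b := by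
        rw [map_sub, map_one, hσ, ← hab]; ring
      obtain ⟨u, hu'⟩ := X.unit hM hu hq hW (s := 1 - (σ a : S)) (by rw [hb]; exact b.ne_zero)
      rw [X.ww_right hM hu hq hW (t' := u) (by rw [hσ, hu', hb])]
      have : ww X.D1 X.D2 (σ a) u = 0 := by
        rw [ww, th, th, th, th, hu']
        simp only [map_sub, Derivation.map_one_eq_zero]
        ring
      rw [this, map_zero])
  refine ⟨φ, fun T => ?_⟩
  induction T using K2_induction with
  | h0 => exact ⟨0, by simp, by simp⟩
  | hs a b =>
    refine ⟨_, hφ a b, ?_⟩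
    have hinv : ∀ s : Sˣ, X.q ((s⁻¹ : Sˣ) : S) = (X.q s)⁻¹ := by
      intro s
      refine eq_inv_of_mul_eq_one_left ?_
      rw [← map_mul, Units.inv_mul, map_one]
    rw [← sf_coe, om_sf]
    simp only [ww, th, map_sub, map_mul, hE1, hE2, hinv, hσ]
    have ha := a.ne_zero
    have hb := b.ne_zero
    field_simp
  | hneg x hx =>
    obtain ⟨s, h1, h2⟩ := hx
    exact ⟨-s, by rw [map_neg, h1, map_neg], by rw [map_neg, h2, map_neg]⟩
  | hadd x y hx hy =>
    obtain ⟨s, h1, h2⟩ := hx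
    obtain ⟨t, h1', h2'⟩ := hy
    exact ⟨s + t, by rw [map_add, h1, h1', map_add], by rw [map_add, h2, h2', map_add]⟩

end Lambda

section Torsion

variable {F : Type*} [Field F] [CharP F 2]

lemma om_UU {k k' : Subfield F} {E1 E2 : Derivation ℤ F F} (h1 : ∀ a ∈ k, E1 a = 0)
    (h2 : ∀ a ∈ k', E2 a = 0) (hk : k ≤ k') {x : K F 2} (hx : x ∈ UU k k' ⊤) : om E1 E2 x = 0 := by
  have : UU k k' ⊤ ≤ (om E1 E2).ker := by
    refine (AddSubgroup.closure_le _).2 ?_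
    rintro t ((⟨c, hc, n, hn, rfl⟩ | ⟨b, hb, b', hb', rfl⟩) | ht)
    · change om E1 E2 _ = 0
      rw [om_sf, h1 c hc, h2 c (hk hc)]; simp
    · change om E1 E2 _ = 0
      rw [om_sf, h2 b hb, h2 b' hb']; simp
    · obtain ⟨y, rfl⟩ := mem_M2.1 ht
      exact om_two _ _ _
  exact this hx

theorem tors_aux (m : ℕ) (T : K F 2) (hT : 2 ^ m • T = 0) : T ∈ M2 F := by
  by_contra hn
  obtain ⟨k, k', u, v, hFk, hkk', huk', huk, hvk', gx, gy, hUU⟩ := lead_form hn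
  have hst : State k k' ⊤ u v := ⟨hkk', le_top, huk', trivial, huk, hvk',
    fun l _ => hFk (sq_mem_Fsq l), gx, fun l _ => gy l⟩
  have hu0 : u ≠ 0 := fun h => huk (h ▸ zero_mem _)
  have hv0 : v ≠ 0 := fun h => hvk' (h ▸ zero_mem _)
  -- derivations
  obtain ⟨d2, hd2, hd2v⟩ := exists_der (hFk.trans hkk') hvk'
  obtain ⟨d1, hd1, hd1u⟩ := exists_der hFk huk
  let E2 : Derivation ℤ F F := v • d2
  let E1 : Derivation ℤ F F := u • (d1 - d1 v • d2)
  have hE2 : ∀ a ∈ k', E2 a = 0 := by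
    intro a ha
    change v * d2 a = 0
    rw [hd2 a ha, mul_zero]
  have hE2v : E2 v = v := by
    change v * d2 v = v
    rw [hd2v, mul_one]
  have hE1 : ∀ a ∈ k, E1 a = 0 := by
    intro a ha
    change u * (d1 a - d1 v * d2 a) = 0
    rw [hd1 a ha, hd2 a (hkk' ha)]; ring
  have hE1u : E1 u = u := by
    change u * (d1 u - d1 v * d2 u) = u
    rw [hd1u, hd2 u huk']; ring
  have hE1v : E1 v = 0 := by
    change u * (d1 v - d1 v * d2 v) = 0
    rw [hd2v]; ring
  have hom : om E1 E2 T = 1 := by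
    have h := om_UU hE1 hE2 hkk' hUU
    rw [map_sub, om_sf, hE1u, hE2v, hE2 u huk', zero_mul, sub_zero,
      div_self (mul_ne_zero hu0 hv0)] at h
    exact sub_eq_zero.1 h
  -- model
  obtain ⟨k0, hk0, hx, hy, huq, hgen⟩ := hst.tower m
  obtain ⟨W, _, ε0, hε0, h2, h2', hmm⟩ := exists_witt k0 m
  let ε : W →+* F := k0.subtype.comp ε0
  have hε : ∀ w, ε w = (ε0 w : F) := fun _ => rfl
  have hz : ∀ w, ε w = 0 ↔ ε0 w = 0 := fun w => by rw [hε]; exact ZeroMemClass.coe_eq_zero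
  have hW : Coef ε m := ⟨h2, by
    intro x y hx hy
    obtain ⟨z, h1, h2⟩ := hmm x y ((hz x).1 hx) ((hz y).1 hy)
    exact ⟨z, (hz z).2 h1, h2⟩⟩
  have hM0 : 0 < 2 ^ (m + 1) := by positivity
  obtain ⟨w1, hw1⟩ := hε0 ⟨_, hx⟩
  obtain ⟨w2, hw2⟩ := hε0 ⟨_, hy⟩
  obtain ⟨S, _, ⟨X⟩⟩ := exists_model ε (2 ^ (m + 1)) hM0 (by push_cast; exact h2) u v w1 w2
    (by rw [hε, hw1]) (by rw [hε, hw2])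
  have hu' : UniqW ε (2 ^ (m + 1)) u v := fun c hc =>
    huq (fun i j => ε (c i j)) (fun i j => (ε0 (c i j)).2) hc
  have hq : Function.Surjective X.q := by
    intro l
    refine hgen X.q.range ?_ ⟨X.x, X.qx⟩ ⟨X.y, X.qy⟩ l trivial
    intro z hz
    obtain ⟨w, hw⟩ := hε0 ⟨z, hz⟩
    exact ⟨X.κ w, by rw [X.qκ, hε, hw]⟩
  obtain ⟨φ, hφ⟩ := X.exists_lambda hM0 hu' hq hW
    (E1 := E1) (E2 := E2) (X.qD1 (fun w => hE1 _ (hk0 (ε0 w).2)) hE1u hE1v)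
    (X.qD2 (fun w => hE2 _ (hkk' (hk0 (ε0 w).2))) (hE2 u huk') hE2v)
  obtain ⟨s, hs, hs'⟩ := hφ T
  rw [hom] at hs'
  have h1 : ε (X.ρ (s - 1)) = 0 := X.ρ_J (X.mem_J hM0 hu' (by rw [map_sub, hs', map_one, sub_self]))
  have hnil : IsNilpotent (X.ρ (s - 1)) := by
    obtain ⟨g, _, e⟩ := hW.pow h1 (m + 1)
    exact ⟨_, e.trans (by rw [h2, zero_mul])⟩
  have hunit : IsUnit (X.ρ s) := by
    have := hnil.isUnit_one_add
    rwa [map_sub, X.ρ1, add_sub_cancel] at this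
  have h0 : (2 : W) ^ m * X.ρ s = 0 := by
    have := congrArg φ hT
    rw [map_nsmul, map_zero, hs, nsmul_eq_mul] at this
    exact_mod_cast this
  exact h2' (hunit.mul_left_eq_zero.1 h0)

theorem two_tors (T : K F 2) (hT : 2 • T = 0) (m : ℕ) : ∃ y, T = 2 ^ m • y := by
  induction m with
  | zero => exact ⟨T, by rw [pow_zero, one_nsmul]⟩
  | succ m ih =>
    obtain ⟨y, rfl⟩ := ih
    have : 2 ^ (m + 1) • y = 0 := by rw [pow_succ', mul_nsmul']; exact hT
    obtain ⟨z, rfl⟩ := mem_M2.1 (tors_aux _ _ this)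
    exact ⟨z, by rw [pow_succ, mul_nsmul']⟩

lemma mem_modSub {n : ℕ} {x : K F 2} : x ∈ modSub F 2 n ↔ ∃ y, x = 2 ^ n • y := by
  constructor
  · intro h
    have : modSub F 2 n ≤ (nsmulAddMonoidHom (α := K F 2) (2 ^ n)).range := by
      refine (AddSubgroup.closure_le _).2 ?_
      rintro _ ⟨y, rfl⟩
      exact ⟨y, rfl⟩
    obtain ⟨y, rfl⟩ := this h
    exact ⟨y, rfl⟩
  · rintro ⟨y, rfl⟩
    exact AddSubgroup.subset_closure ⟨y, rfl⟩

end Torsion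

end Milnor

theorem stmt13 (F : Type*) [Field F] [CharP F 2] (m : ℕ) (hm : 1 ≤ m)
    (w : Milnor.K F 2) (α β γ δ a b : Fˣ)
    (hlift : (QuotientAddGroup.mk (2 • w) : KMod F 2 (m + 1)) =
      Milnor.symbol (m + 1) ![α, β] + Milnor.symbol (m + 1) ![γ, δ] +
        Milnor.symbol (m + 1) ![a, b]) :
    ∃ k : ℕ, k ≤ 15 ∧ ∃ u v : Fin k → Fˣ,
      (QuotientAddGroup.mk w : KMod F 2 m) = ∑ i, Milnor.symbol m ![u i, v i] := by
  have h1 : (QuotientAddGroup.mk (2 • w) : K F 2 ⧸ modSub F 2 (m + 1)) =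
      QuotientAddGroup.mk (sy α β + sy γ δ + sy a b) := hlift
  rw [QuotientAddGroup.eq] at h1
  obtain ⟨z, hz⟩ := mem_modSub.1 h1
  have hT : sf (α : F) β + sf (γ : F) δ + sf (a : F) b = 2 • (w + 2 ^ m • z) := by
    rw [sf_coe, sf_coe, sf_coe, nsmul_add, ← mul_nsmul', ← pow_succ', ← hz]; abel
  have hka : ka (α : F) β + ka (γ : F) δ + ka (a : F) b = 0 := by
    have : ka (α : F) β + ka (γ : F) δ + ka (a : F) b =
      QuotientAddGroup.mk' (M2 F) (sf (α : F) β + sf (γ : F) δ + sf (a : F) b) := rfl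
    rw [this, hT]
    exact (QuotientAddGroup.eq_zero_iff _).2 (mem_M2.2 ⟨_, rfl⟩)
  obtain ⟨y, ⟨u, v, hy⟩, e⟩ := three_cost α.ne_zero β.ne_zero γ.ne_zero δ.ne_zero a.ne_zero b.ne_zero hka
  obtain ⟨t, ht⟩ := two_tors (w + 2 ^ m • z - y) (by rw [nsmul_sub, ← hT, e, sub_self]) m
  refine ⟨15, le_rfl, u, v, ?_⟩
  have h2 : ∑ i, Milnor.symbol m ![u i, v i] =
      QuotientAddGroup.mk' (modSub F 2 m) (∑ i, sy (u i) (v i)) := by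
    rw [map_sum]; rfl
  refine Eq.trans ?_ h2.symm
  rw [← hy]
  refine QuotientAddGroup.eq.2 (mem_modSub.2 ⟨z - t, ?_⟩)
  rw [nsmul_sub, ← ht]; abel
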